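/- Let P = P_{n,r} be the poset of r-colored injective words with the natural 𝔖_n-action and let λ be a partition of n. For an r-colored standard Young tableau Q of shape λ, let m(Q) be the largest i ∈ {0,1,…,n} such that all the numbers 1,2,…,i appear in the first row of Q and are colored with the zero color. Then the multiplicity of ρ^λ in β_P({1,…,n−1}) equals the number of r-colored standard Young tableaux Q of shape λ with m(Q) odd, and the multiplicity of ρ^λ in β_P({1,…,n}) equals the number of r-colored standard Young tableaux Q of shape λ with m(Q) even. -/

import Mathlib

open scoped Classical

noncomputable section

/-! ### Permutation combinatorics -/

/-- The value `w(i)` (1-based, in `{1,…,n}`) of a permutation `w` of `{1,…,n}`,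
realized as `Equiv.Perm (Fin n)`. -/
def permApp {n : ℕ} (w : Equiv.Perm (Fin n)) (i : ℕ) : ℕ :=
  if h : i - 1 < n then (w ⟨i - 1, h⟩ : ℕ) + 1 else 0

/-- The descent set of a permutation, a subset of `{1,…,n-1}`. -/
def descentSet {n : ℕ} (w : Equiv.Perm (Fin n)) : Finset ℕ :=
  (Finset.Icc 1 (n - 1)).filter fun i => permApp w (i + 1) < permApp w i

/-- `numDescentSet m T` is the number of permutations in `𝔖_m` with descent set `T`. -/
def numDescentSet (m : ℕ) (T : Finset ℕ) : ℕ :=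
  Nat.card {w : Equiv.Perm (Fin m) // descentSet w = T}

/-- The Coxeter length (number of inversions) of a permutation. -/
def invCount {n : ℕ} (w : Equiv.Perm (Fin n)) : ℕ :=
  (Finset.univ.filter fun p : Fin n × Fin n => p.1 < p.2 ∧ w p.2 < w p.1).card

/-- For `S = {s_1 < s_2 < ⋯ < s_k} ⊆ {1,…,n-1}`, `sElt n S j = s_j`, with the
conventions `s_0 = 0` and `s_j = n` for `j > k`. -/
def sElt (n : ℕ) (S : Finset ℕ) (j : ℕ) : ℕ :=
  if j = 0 then 0 else if j ≤ S.card then (S.sort (· ≤ ·)).getD (j - 1) 0 else n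

lemma sElt_of_gt (n : ℕ) (S : Finset ℕ) (j : ℕ) (h : S.card < j) : sElt n S j = n := by
  unfold sElt
  rw [if_neg (by omega), if_neg (by omega)]

/-! ### Standard Young tableaux -/

/-- A standard Young tableau of shape `μ`: a filling of the cells of `μ` by the numbers
`1,…,μ.card`, each used once, strictly increasing along rows and columns
(the entry of a non-cell is `0`). -/
structure SYT (μ : YoungDiagram) where
  entry : ℕ → ℕ → ℕ
  entry_eq_zero : ∀ i j, (i, j) ∉ μ → entry i j = 0
  row_strict : ∀ i j1 j2, j1 < j2 → (i, j2) ∈ μ → entry i j1 < entry i j2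
  col_strict : ∀ i1 i2 j, i1 < i2 → (i2, j) ∈ μ → entry i1 j < entry i2 j
  bijOn : Set.BijOn (fun p : ℕ × ℕ => entry p.1 p.2) ↑μ.cells ↑(Finset.Icc 1 μ.card)

/-- The descent set of a standard Young tableau: those `k` such that `k+1` lies in a
strictly lower row than `k`. -/
def SYT.des {μ : YoungDiagram} (Q : SYT μ) : Finset ℕ :=
  (Finset.Icc 1 (μ.card - 1)).filter fun k =>
    ∃ p1 ∈ μ.cells, ∃ p2 ∈ μ.cells,
      Q.entry p1.1 p1.2 = k ∧ Q.entry p2.1 p2.2 = k + 1 ∧ p1.1 < p2.1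

/-- `fSYTRow μ t` is the number of standard Young tableaux of shape `μ` whose first row
contains the numbers `1,…,t`. -/
def fSYTRow (μ : YoungDiagram) (t : ℕ) : ℕ :=
  Nat.card {Q : SYT μ // ∀ k, 1 ≤ k → k ≤ t → ∃ j, (0, j) ∈ μ ∧ Q.entry 0 j = k}

/-! ### Irreducible characters of the symmetric group, via Jacobi–Trudi -/

/-- The number of functions `f : Fin n → Fin k` which are invariant under `g` and whose
fiber over `i` has `c i` elements.  For `c` a composition of `n`, the function
`g ↦ fixedYoungFns n k c g` is the character of the permutation representation of `𝔖_n`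
on ordered set partitions of `{1,…,n}` of type `c`, i.e. of the representation induced
from the trivial representation of the corresponding Young subgroup. -/
def fixedYoungFns (n k : ℕ) (c : Fin k → ℤ) (g : Equiv.Perm (Fin n)) : ℕ :=
  Nat.card {f : Fin n → Fin k //
    (∀ x, f (g x) = f x) ∧ ∀ i, ((Nat.card {x : Fin n // f x = i} : ℕ) : ℤ) = c i}

/-- The irreducible character `χ^μ` of `𝔖_n` associated to a partition `μ` of `n`
(encoded as a Young diagram with `n` cells), defined through the Jacobi–Trudi
determinantal formula `χ^μ = det (h_{μ_i - i + j})`. -/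
def chi (n : ℕ) (μ : YoungDiagram) (g : Equiv.Perm (Fin n)) : ℤ :=
  ∑ σ : Equiv.Perm (Fin μ.rowLens.length),
    ((Equiv.Perm.sign σ : ℤˣ) : ℤ) *
      (fixedYoungFns n μ.rowLens.length
        (fun i => ((μ.rowLen (i : ℕ) : ℕ) : ℤ) - ((i : ℕ) : ℤ) + ((σ i : ℕ) : ℤ)) g : ℤ)

/-! ### Posets, rank selection, maximal chains and characters -/

/-- The maximal chains of the subposet induced on a subset `A` of a poset. -/
def maxChainsIn {P : Type*} [Preorder P] (A : Set P) : Set (Set P) :=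
  {C | C ⊆ A ∧ IsChain (· ≤ ·) C ∧
    ∀ D : Set P, D ⊆ A → IsChain (· ≤ ·) D → C ⊆ D → C = D}

/-- The rank-selected subposet `P_S = {x ∈ P : rk x ∈ S} ∪ {⊥, ⊤}`. -/
def rankSel {P : Type*} [Preorder P] [OrderBot P] [OrderTop P] (rk : P → ℕ)
    (S : Finset ℕ) : Set P :=
  {x | rk x ∈ S} ∪ {⊥, ⊤}

/-- `a_P(S)`: the number of maximal chains of the rank-selected subposet `P_S`. -/
def chainCount {P : Type*} [Preorder P] [OrderBot P] [OrderTop P] (rk : P → ℕ)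
    (S : Finset ℕ) : ℕ :=
  Set.ncard (maxChainsIn (rankSel rk S))

/-- `b_P(S) = Σ_{T ⊆ S} (-1)^{|S-T|} a_P(T)`. -/
def bDim {P : Type*} [Preorder P] [OrderBot P] [OrderTop P] (rk : P → ℕ)
    (S : Finset ℕ) : ℤ :=
  ∑ T ∈ S.powerset, (-1 : ℤ) ^ (S.card - T.card) * (chainCount rk T : ℤ)

/-- The character of the permutation representation `α_P(S)` of a group `G` acting (via
`act`) on the maximal chains of the rank-selected subposet `P_S`: its value at `g` is
the number of maximal chains of `P_S` fixed by `g`. -/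
def gAlpha {P G : Type*} [Preorder P] [OrderBot P] [OrderTop P] (rk : P → ℕ)
    (act : G → P → P) (S : Finset ℕ) (g : G) : ℤ :=
  (Set.ncard {C : Set P | C ∈ maxChainsIn (rankSel rk S) ∧ act g '' C = C} : ℤ)

/-- The character of the virtual representation
`β_P(S) = Σ_{T ⊆ S} (-1)^{|S-T|} α_P(T)`. -/
def gBeta {P G : Type*} [Preorder P] [OrderBot P] [OrderTop P] (rk : P → ℕ)
    (act : G → P → P) (S : Finset ℕ) (g : G) : ℤ :=
  ∑ T ∈ S.powerset, (-1 : ℤ) ^ (S.card - T.card) * gAlpha rk act T g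

/-! ### The poset of injective words -/

/-- An injective word over the alphabet `{1,…,n}`. -/
def InjWord (n : ℕ) : Type := {l : List (Fin n) // l.Nodup}

instance (n : ℕ) : PartialOrder (InjWord n) where
  le u v := u.1.Sublist v.1
  le_refl u := List.Sublist.refl _
  le_trans u v w h1 h2 := List.Sublist.trans h1 h2
  le_antisymm u v h1 h2 := Subtype.ext (List.Sublist.antisymm h1 h2)

instance (n : ℕ) : OrderBot (InjWord n) where
  bot := ⟨[], List.nodup_nil⟩
  bot_le u := List.nil_sublist u.1

/-- The rank function of the poset of injective words (with a maximum adjoined):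
the rank of a word is its length, and the rank of `⊤` is `n+1`. -/
def rkInj (n : ℕ) (x : WithTop (InjWord n)) : ℕ :=
  WithTop.recTopCoe (n + 1) (fun u => u.1.length) x

/-- The action of `𝔖_n` on injective words, letter by letter. -/
def permWord {n : ℕ} (w : Equiv.Perm (Fin n)) (u : InjWord n) : InjWord n :=
  ⟨u.1.map w, u.2.map w.injective⟩

/-- The character of `α_{P_n}(S)` for the `𝔖_n`-action on the poset of injective words. -/
def injAlpha (n : ℕ) (S : Finset ℕ) (g : Equiv.Perm (Fin n)) : ℤ :=
  gAlpha (rkInj n) (fun w : Equiv.Perm (Fin n) => WithTop.map (permWord w)) S g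

/-- The character of `β_{P_n}(S)` for the `𝔖_n`-action on the poset of injective words. -/
def injBeta (n : ℕ) (S : Finset ℕ) (g : Equiv.Perm (Fin n)) : ℤ :=
  gBeta (rkInj n) (fun w : Equiv.Perm (Fin n) => WithTop.map (permWord w)) S g

/-! ### The poset of r-colored injective words -/

/-- An `r`-colored injective word over `{1,…,n}`: a word in the alphabet
`{1,…,n} × ℤ_r` whose letters have pairwise distinct first coordinates. -/
def CInjWord (n r : ℕ) : Type := {l : List (Fin n × ZMod r) // (l.map Prod.fst).Nodup}

instance (n r : ℕ) : PartialOrder (CInjWord n r) where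
  le u v := u.1.Sublist v.1
  le_refl u := List.Sublist.refl _
  le_trans u v w h1 h2 := List.Sublist.trans h1 h2
  le_antisymm u v h1 h2 := Subtype.ext (List.Sublist.antisymm h1 h2)

instance (n r : ℕ) : OrderBot (CInjWord n r) where
  bot := ⟨[], by simp⟩
  bot_le u := List.nil_sublist u.1

/-- The rank function of the poset `P_{n,r}` of `r`-colored injective words
(with a maximum adjoined). -/
def rkC (n r : ℕ) (x : WithTop (CInjWord n r)) : ℕ :=
  WithTop.recTopCoe (n + 1) (fun u => u.1.length) x

/-- The action of `𝔖_n` on `r`-colored injective words: act on the first coordinate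
of each letter, leaving colors unchanged. -/
def permCWord {n r : ℕ} (w : Equiv.Perm (Fin n)) (u : CInjWord n r) : CInjWord n r :=
  ⟨u.1.map (fun p => (w p.1, p.2)), by
    have h := u.2.map w.injective
    rw [List.map_map] at h ⊢
    exact h⟩

/-- The character of `α_{P_{n,r}}(S)`. -/
def cAlpha (n r : ℕ) (S : Finset ℕ) (g : Equiv.Perm (Fin n)) : ℤ :=
  gAlpha (rkC n r) (fun w : Equiv.Perm (Fin n) => WithTop.map (permCWord w)) S g

/-- The character of `β_{P_{n,r}}(S)`. -/
def cBeta (n r : ℕ) (S : Finset ℕ) (g : Equiv.Perm (Fin n)) : ℤ :=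
  gBeta (rkC n r) (fun w : Equiv.Perm (Fin n) => WithTop.map (permCWord w)) S g

/-- `b_{P_{n,r}}(S)`, the dimension of `β_{P_{n,r}}(S)`. -/
def cChainDim (n r : ℕ) (S : Finset ℕ) : ℤ := bDim (rkC n r) S

/-! ### The statistics τ -/

/-- `τ(w,Q)` for a permutation `w` with descent set `S = {s_1 < ⋯ < s_k}` and a standard
Young tableau `Q`: the largest `i ∈ {0,…,k+1}` such that (a) `w(x) = w_S(x)` for
`x > s_{k+1-i}` and (b) no descent of `Q` is smaller than `n - s_{k+1-i}`. -/
def tau (n : ℕ) (S : Finset ℕ) (wS w : Equiv.Perm (Fin n)) {μ : YoungDiagram}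
    (Q : SYT μ) : ℕ :=
  ((Finset.range (S.card + 2)).filter
    (fun i => (∀ x, sElt n S (S.card + 1 - i) < x → x ≤ n → permApp w x = permApp wS x) ∧
      (∀ d ∈ Q.des, n - sElt n S (S.card + 1 - i) ≤ d))).max'
    ⟨0, by
      have hs := sElt_of_gt n S (S.card + 1 - 0) (by omega)
      refine Finset.mem_filter.2 ⟨Finset.mem_range.2 (by omega), ?_, ?_⟩
      · intro x hx hx'
        rw [hs] at hx
        exact absurd hx (not_lt.2 hx')
      · intro d _
        rw [hs]
        omega⟩

/-- The condition that all the numbers `1,…,t` appear in the first row of the `r`-colored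
standard Young tableau `(Q, c)` and are colored with the zero color (the color of the
entry `k` being `c (k-1)`). -/
def zeroFirstRow {μ : YoungDiagram} {r : ℕ} (Q : SYT μ) (c : Fin μ.card → ZMod r)
    (t : ℕ) : Prop :=
  ∀ k : Fin μ.card, (k : ℕ) < t →
    ((∃ j, (0, j) ∈ μ ∧ Q.entry 0 j = (k : ℕ) + 1) ∧ c k = 0)

/-- `τ(w,Q)` for an `r`-colored standard Young tableau `(Q,c)`. -/
def ctau (n : ℕ) {r : ℕ} (S : Finset ℕ) (wS w : Equiv.Perm (Fin n)) {μ : YoungDiagram}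
    (Q : SYT μ) (c : Fin μ.card → ZMod r) : ℕ :=
  ((Finset.range (S.card + 2)).filter
    (fun i => (∀ x, sElt n S (S.card + 1 - i) < x → x ≤ n → permApp w x = permApp wS x) ∧
      zeroFirstRow Q c (n - sElt n S (S.card + 1 - i)))).max'
    ⟨0, by
      have hs := sElt_of_gt n S (S.card + 1 - 0) (by omega)
      refine Finset.mem_filter.2 ⟨Finset.mem_range.2 (by omega), ?_, ?_⟩
      · intro x hx hx'
        rw [hs] at hx
        exact absurd hx (not_lt.2 hx')
      · rw [hs]
        intro k hk
        exact absurd hk (by omega)⟩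

/-- The largest `i ∈ {0,…,n}` such that all the numbers `1,…,i` appear in the first row
of the `r`-colored standard Young tableau `(Q,c)` and are colored with the zero color. -/
def mQ (n : ℕ) {r : ℕ} {μ : YoungDiagram} (Q : SYT μ) (c : Fin μ.card → ZMod r) : ℕ :=
  ((Finset.range (n + 1)).filter (fun i => zeroFirstRow Q c i)).max'
    ⟨0, Finset.mem_filter.2 ⟨Finset.mem_range.2 (by omega),
      fun k hk => absurd hk (by omega)⟩⟩

/-- The condition, for an `r`-colored permutation `(π, c)` (the color of the entry
`π(x)` in one-line notation being `c (x-1)`), that the entries `π(1),…,π(t)` are in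
increasing order and all colored with the zero color. -/
def zeroIncreasing {n r : ℕ} (π : Equiv.Perm (Fin n)) (c : Fin n → ZMod r) (t : ℕ) : Prop :=
  (∀ x y, 1 ≤ x → x < y → y ≤ t → permApp π x < permApp π y) ∧
  ∀ k : Fin n, (k : ℕ) < t → c k = 0

/-- `τ(w,u)` for an `r`-colored permutation `u = (π, c)`. -/
def tauU (n : ℕ) {r : ℕ} (S : Finset ℕ) (wS w : Equiv.Perm (Fin n))
    (π : Equiv.Perm (Fin n)) (c : Fin n → ZMod r) : ℕ :=
  ((Finset.range (S.card + 2)).filter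
    (fun i => (∀ x, sElt n S (S.card + 1 - i) < x → x ≤ n → permApp w x = permApp wS x) ∧
      zeroIncreasing π c (n - sElt n S (S.card + 1 - i)))).max'
    ⟨0, by
      have hs := sElt_of_gt n S (S.card + 1 - 0) (by omega)
      refine Finset.mem_filter.2 ⟨Finset.mem_range.2 (by omega), ?_, ?_, ?_⟩
      · intro x hx hx'
        rw [hs] at hx
        exact absurd hx (not_lt.2 hx')
      · intro x y hx hxy hy
        rw [hs] at hy
        exact absurd hy (by omega)
      · rw [hs]
        intro k hk
        exact absurd hk (by omega)⟩

/-- The largest `i ∈ {0,…,n}` such that the entries `π(1),…,π(i)` of the `r`-colored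
permutation `(π,c)` are in increasing order and all colored with the zero color. -/
def mU (n : ℕ) {r : ℕ} (π : Equiv.Perm (Fin n)) (c : Fin n → ZMod r) : ℕ :=
  ((Finset.range (n + 1)).filter (fun i => zeroIncreasing π c i)).max'
    ⟨0, Finset.mem_filter.2 ⟨Finset.mem_range.2 (by omega),
      fun x y hx hxy hy => absurd hy (by omega),
      fun k hk => absurd hk (by omega)⟩⟩

/-- `a_m(T)`: the number of chains in the Boolean lattice `B_m` whose elements have
set of ranks (cardinalities) equal to `T`. -/
def boolChains (m : ℕ) (T : Finset ℕ) : ℕ :=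
  Nat.card {c : Finset (Finset (Fin m)) //
    IsChain (· ⊆ ·) (↑c : Set (Finset (Fin m))) ∧ c.image Finset.card = T}

end


/-! ### Burnside count -/

/-- pairs (injection, function of content `c`) -/
def BX (n k l : ℕ) (c : Fin l → ℤ) : Type :=
  (Fin k ↪ Fin n) × {f : Fin n → Fin l // ∀ i, ((Nat.card {x : Fin n // f x = i} : ℕ) : ℤ) = c i}

noncomputable instance (n k l : ℕ) (c : Fin l → ℤ) : Fintype (BX n k l c) := by
  unfold BX; infer_instance

lemma card_fiber_perm {n l : ℕ} (f : Fin n → Fin l) (g : Equiv.Perm (Fin n)) (i : Fin l) :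
    Nat.card {x : Fin n // f (g x) = i} = Nat.card {x : Fin n // f x = i} :=
  Nat.card_congr (g.subtypeEquiv (fun _ => Iff.rfl))

instance (n k l : ℕ) (c : Fin l → ℤ) : MulAction (Equiv.Perm (Fin n)) (BX n k l c) where
  smul g x := ⟨x.1.trans g.toEmbedding, ⟨fun y => x.2.1 (g⁻¹ y), fun i => by
    rw [card_fiber_perm]; exact x.2.2 i⟩⟩
  one_smul x := rfl
  mul_smul g h x := by
    refine Prod.ext ?_ (Subtype.ext ?_)
    · ext; rfl
    · funext y
      change x.2.1 ((g * h)⁻¹ y) = x.2.1 (h⁻¹ (g⁻¹ y))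
      rw [mul_inv_rev]; rfl

lemma BX_smul_def {n k l : ℕ} {c : Fin l → ℤ} (g : Equiv.Perm (Fin n)) (x y : BX n k l c) :
    g • x = y ↔ (∀ m, g (x.1 m) = y.1 m) ∧ ∀ z, y.2.1 (g z) = x.2.1 z := by
  constructor
  · rintro rfl
    refine ⟨fun m => rfl, fun z => ?_⟩
    change x.2.1 (g⁻¹ (g z)) = _
    simp
  · rintro ⟨h1, h2⟩
    refine Prod.ext ?_ (Subtype.ext ?_)
    · ext m; exact congrArg Fin.val (h1 m)
    · funext z
      change x.2.1 (g⁻¹ z) = _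
      rw [← h2]; simp

/-- words with content bounded by `c` -/
noncomputable def wordCount (k l : ℕ) (c : Fin l → ℤ) : ℕ :=
  Nat.card {w : Fin k → Fin l // ∀ i, ((Nat.card {m : Fin k // w m = i} : ℕ) : ℤ) ≤ c i}

/-- code of a pair: value `inr m` at `a m` -/
noncomputable def BXcode {n k l : ℕ} {c : Fin l → ℤ} (x : BX n k l c) (z : Fin n) :
    Fin l ⊕ Fin k :=
  if h : ∃ m, x.1 m = z then Sum.inr h.choose else Sum.inl (x.2.1 z)

lemma BXcode_app {n k l : ℕ} {c : Fin l → ℤ} (x : BX n k l c) (m : Fin k) :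
    BXcode x (x.1 m) = Sum.inr m := by
  unfold BXcode
  have h : ∃ m', x.1 m' = x.1 m := ⟨m, rfl⟩
  rw [dif_pos h]
  exact congrArg Sum.inr (x.1.injective h.choose_spec)

lemma BXcode_inr {n k l : ℕ} {c : Fin l → ℤ} (x : BX n k l c) (z : Fin n) (m : Fin k) :
    BXcode x z = Sum.inr m ↔ x.1 m = z := by
  constructor
  · intro h
    unfold BXcode at h
    split_ifs at h with h'
    rw [← Sum.inr.inj h]; exact h'.choose_spec
  · rintro rfl; exact BXcode_app x m

lemma BXcode_inl {n k l : ℕ} {c : Fin l → ℤ} (x : BX n k l c) (z : Fin n) (i : Fin l) :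
    BXcode x z = Sum.inl i ↔ x.2.1 z = i ∧ ¬ ∃ m, x.1 m = z := by
  unfold BXcode
  split_ifs with h
  · simp [h]
  · simp [h]

lemma BX_fiber_card {n k l : ℕ} {c : Fin l → ℤ} (x : BX n k l c) (i : Fin l) :
    Nat.card {z // BXcode x z = Sum.inl i} + Nat.card {m : Fin k // x.2.1 (x.1 m) = i}
      = Nat.card {z // x.2.1 z = i} := by
  simp only [Nat.card_eq_fintype_card, Fintype.card_subtype]
  have h1 : (Finset.univ.filter (fun m : Fin k => x.2.1 (x.1 m) = i)).card
      = (Finset.univ.filter (fun z => x.2.1 z = i ∧ ∃ m, x.1 m = z)).card := by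
    rw [← Finset.card_map x.1]
    congr 1
    ext z
    simp only [Finset.mem_map, Finset.mem_filter, Finset.mem_univ, true_and]
    constructor
    · rintro ⟨m, hm, rfl⟩; exact ⟨hm, m, rfl⟩
    · rintro ⟨hm, m, rfl⟩; exact ⟨m, hm, rfl⟩
  rw [h1]
  simp only [BXcode_inl]
  rw [← Finset.filter_filter, ← Finset.filter_filter, add_comm]
  exact Finset.card_filter_add_card_filter_not _

lemma BX_orbit {n k l : ℕ} {c : Fin l → ℤ} (x y : BX n k l c)
    (h : ∀ m, x.2.1 (x.1 m) = y.2.1 (y.1 m)) : ∃ g : Equiv.Perm (Fin n), g • x = y := by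
  have key : ∀ s, Nonempty ({z // BXcode x z = s} ≃ {z // BXcode y z = s}) := by
    intro s
    rw [← Finite.card_eq]
    rcases s with i | m
    · have hx := BX_fiber_card x i
      have hy := BX_fiber_card y i
      have h2 : Nat.card {m : Fin k // x.2.1 (x.1 m) = i}
          = Nat.card {m : Fin k // y.2.1 (y.1 m) = i} := by simp only [h]
      have h3 := (x.2.2 i).trans (y.2.2 i).symm
      have h4 : Nat.card {z // x.2.1 z = i} = Nat.card {z // y.2.1 z = i} := by exact_mod_cast h3
      omega
    · simp only [BXcode_inr]
      simp
  let e := Equiv.ofFiberEquiv (fun s => (key s).some)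
  have he : ∀ z, BXcode y (e z) = BXcode x z := fun z => Equiv.ofFiberEquiv_map _ z
  have h1 : ∀ m, e (x.1 m) = y.1 m := by
    intro m
    have := he (x.1 m)
    rw [BXcode_app, BXcode_inr] at this
    exact this.symm
  refine ⟨e, (BX_smul_def _ _ _).2 ⟨h1, fun z => ?_⟩⟩
  rcases hz : BXcode x z with i | m
  · have h2 := he z
    rw [hz, BXcode_inl] at h2
    rw [BXcode_inl] at hz
    rw [h2.1, hz.1]
  · rw [BXcode_inr] at hz
    subst hz
    rw [h1, h]

lemma exists_content {n l : ℕ} {c : Fin l → ℤ} (hc : ∑ i, c i = n) (h0 : ∀ i, 0 ≤ c i) :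
    ∃ f : Fin n → Fin l, ∀ i, ((Nat.card {x : Fin n // f x = i} : ℕ) : ℤ) = c i := by
  have hcard : Fintype.card (Fin n) = Fintype.card (Σ i : Fin l, Fin (c i).toNat) := by
    simp only [Fintype.card_fin, Fintype.card_sigma]
    zify
    rw [← hc]
    exact Finset.sum_congr rfl fun i _ => (Int.toNat_of_nonneg (h0 i)).symm
  let e := Fintype.equivOfCardEq hcard
  refine ⟨fun z => (e z).1, fun i => ?_⟩
  have : Nat.card {x : Fin n // (e x).1 = i} = (c i).toNat := by
    rw [Nat.card_congr (e.subtypeEquiv (q := fun s => s.1 = i) (fun _ => Iff.rfl)),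
      Nat.card_congr (Equiv.sigmaSubtype i)]
    simp
  rw [this]; exact Int.toNat_of_nonneg (h0 i)

lemma BX_exists {n k l : ℕ} {c : Fin l → ℤ} (hc : ∑ i, c i = n) (w : Fin k → Fin l)
    (hw : ∀ i, ((Nat.card {m : Fin k // w m = i} : ℕ) : ℤ) ≤ c i) :
    ∃ x : BX n k l c, ∀ m, x.2.1 (x.1 m) = w m := by
  obtain ⟨f, hf⟩ := exists_content hc (fun i => le_trans (by positivity) (hw i))
  have he : ∀ i, Nonempty ({m : Fin k // w m = i} ↪ {x : Fin n // f x = i}) := by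
    intro i
    rw [Function.Embedding.nonempty_iff_card_le, ← Nat.card_eq_fintype_card,
      ← Nat.card_eq_fintype_card]
    have := hw i
    rw [← hf i] at this
    exact_mod_cast this
  have hfa : ∀ m, f ((he (w m)).some ⟨m, rfl⟩).1 = w m := fun m =>
    ((he (w m)).some ⟨m, rfl⟩).2
  have gen : ∀ (i j : Fin l) (m m' : Fin k) (hm : w m = i) (hm' : w m' = j), i = j →
      ((he i).some ⟨m, hm⟩).1 = ((he j).some ⟨m', hm'⟩).1 → m = m' := by
    rintro i _ m m' hm hm' rfl h
    have := (he i).some.injective (Subtype.ext h)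
    exact congrArg Subtype.val this
  refine ⟨⟨⟨fun m => ((he (w m)).some ⟨m, rfl⟩).1, ?_⟩, ⟨f, hf⟩⟩, hfa⟩
  intro m m' h
  refine gen _ _ m m' rfl rfl ?_ h
  rw [← hfa m, ← hfa m']
  exact congrArg f h

lemma card_orbits (n k l : ℕ) (c : Fin l → ℤ) (hc : ∑ i, c i = n) :
    Nat.card (Quotient (MulAction.orbitRel (Equiv.Perm (Fin n)) (BX n k l c)))
      = wordCount k l c := by
  unfold wordCount
  let F : BX n k l c →
      {w : Fin k → Fin l // ∀ i, ((Nat.card {m : Fin k // w m = i} : ℕ) : ℤ) ≤ c i} :=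
    fun x => ⟨fun m => x.2.1 (x.1 m), fun i => by
      rw [← x.2.2 i]
      have := BX_fiber_card x i
      exact_mod_cast (by omega : Nat.card {m : Fin k // x.2.1 (x.1 m) = i}
        ≤ Nat.card {z // x.2.1 z = i})⟩
  have hF : ∀ x y, (MulAction.orbitRel (Equiv.Perm (Fin n)) (BX n k l c)) x y ↔ F x = F y := by
    intro x y
    rw [MulAction.orbitRel_apply]
    constructor
    · rintro ⟨g, hg⟩
      have hg' : g • y = x := hg
      rw [BX_smul_def] at hg'
      apply Subtype.ext
      funext m
      change x.2.1 (x.1 m) = y.2.1 (y.1 m)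
      rw [← hg'.1 m, hg'.2]
    · intro h
      obtain ⟨g, hg⟩ := BX_orbit y x (fun m => (congrFun (congrArg Subtype.val h) m).symm)
      exact ⟨g, hg⟩
  refine Nat.card_congr (Equiv.ofBijective (Quotient.lift F (fun x y h => (hF x y).1 h)) ⟨?_, ?_⟩)
  · intro a b
    induction a using Quotient.inductionOn
    induction b using Quotient.inductionOn
    intro h
    exact Quotient.sound ((hF _ _).2 h)
  · rintro ⟨w, hw⟩
    obtain ⟨x, hx⟩ := BX_exists hc w hw
    exact ⟨Quotient.mk _ x, Subtype.ext (funext hx)⟩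

/-- injections into fixed points -/
noncomputable def fixEmb (n k : ℕ) (g : Equiv.Perm (Fin n)) : ℕ :=
  Nat.card {a : Fin k ↪ Fin n // ∀ m, g (a m) = a m}

lemma burnside_count (n k l : ℕ) (c : Fin l → ℤ) (hc : ∑ i, c i = n) :
    ∑ g : Equiv.Perm (Fin n), fixEmb n k g * fixedYoungFns n l c g
      = wordCount k l c * n.factorial := by
  have := MulAction.sum_card_fixedBy_eq_card_orbits_mul_card_group
    (Equiv.Perm (Fin n)) (BX n k l c)
  rw [← card_orbits n k l c hc, Nat.card_eq_fintype_card]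
  rw [Fintype.card_perm, Fintype.card_fin] at this
  rw [← this]
  refine Finset.sum_congr rfl fun g _ => ?_
  unfold fixEmb fixedYoungFns
  rw [← Nat.card_prod, ← Nat.card_eq_fintype_card]
  refine Nat.card_congr ?_
  refine ⟨fun p => ⟨(p.1.1, ⟨p.2.1, p.2.2.2⟩), ?_⟩, fun x => ⟨⟨x.1.1, ?_⟩, ⟨x.1.2.1, ?_, x.1.2.2⟩⟩,
    fun _ => rfl, fun _ => rfl⟩
  · exact (BX_smul_def _ _ _).2 ⟨p.1.2, p.2.2.1⟩
  · exact ((BX_smul_def _ _ _).1 x.2).1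
  · exact ((BX_smul_def _ _ _).1 x.2).2

/-! ### The determinant recursion -/

lemma wordCount_zero (l : ℕ) (c : Fin l → ℤ) :
    wordCount 0 l c = if ∀ i, 0 ≤ c i then 1 else 0 := by
  unfold wordCount
  split_ifs with h
  · rw [Nat.card_eq_one_iff_unique]
    refine ⟨⟨fun a b => Subtype.ext (Subsingleton.elim _ _)⟩, ⟨⟨Fin.elim0, fun i => ?_⟩⟩⟩
    simpa using h i
  · rw [Nat.card_eq_zero]
    left
    refine ⟨fun w => h fun i => ?_⟩
    exact le_trans (by positivity) (w.2 i)

lemma card_fiber_cons {k l : ℕ} (j : Fin l) (w : Fin k → Fin l) (i : Fin l) :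
    Nat.card {m : Fin (k + 1) // (Fin.cons j w : Fin (k + 1) → Fin l) m = i}
      = (if i = j then 1 else 0) + Nat.card {m : Fin k // w m = i} := by
  simp only [Nat.card_eq_fintype_card, Fintype.card_subtype, Fin.card_filter_univ_succ,
    Fin.cons_zero, Fin.cons_succ]
  by_cases h : j = i
  · simp [h, add_comm]
  · simp [h, Ne.symm h]

lemma wordCount_succ (k l : ℕ) (c : Fin l → ℤ) :
    wordCount (k + 1) l c = ∑ j, wordCount k l (c - Pi.single j 1) := by
  unfold wordCount
  rw [← Nat.card_sigma]
  have key : ∀ (j : Fin l) (w : Fin k → Fin l),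
      (∀ i, ((Nat.card {m : Fin (k + 1) // (Fin.cons j w : Fin (k + 1) → Fin l) m = i} : ℕ) : ℤ)
        ≤ c i) ↔
      ∀ i, ((Nat.card {m : Fin k // w m = i} : ℕ) : ℤ) ≤ (c - (Pi.single j 1 : Fin l → ℤ)) i := by
    intro j w
    refine forall_congr' fun i => ?_
    rw [card_fiber_cons]
    simp only [Pi.sub_apply, Pi.single_apply]
    split_ifs <;> push_cast <;> constructor <;> intro h <;> linarith
  refine Nat.card_congr ⟨fun w => ⟨w.1 0, ⟨Fin.tail w.1, ?_⟩⟩,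
    fun x => ⟨Fin.cons x.1 x.2.1, ?_⟩, ?_, ?_⟩
  · rw [← key, Fin.cons_self_tail]; exact w.2
  · rw [key]; exact x.2.2
  · intro w; exact Subtype.ext (Fin.cons_self_tail _)
  · intro x; rfl

/-- iterated determinant -/
noncomputable def detG (l : ℕ) : ℕ → (Fin l → ℤ) → ℤ
  | 0, v => Matrix.det (Matrix.of fun i j : Fin l => if 0 ≤ v i + ((j : ℕ) : ℤ) then (1 : ℤ) else 0)
  | k + 1, v => ∑ j, detG l k (v - Pi.single j 1)

lemma sum_wordCount (l k : ℕ) (v : Fin l → ℤ) :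
    ∑ σ : Equiv.Perm (Fin l), ((Equiv.Perm.sign σ : ℤˣ) : ℤ) *
      (wordCount k l (fun i => v i + ((σ i : ℕ) : ℤ)) : ℤ) = detG l k v := by
  induction k generalizing v with
  | zero =>
    rw [detG, ← Matrix.det_transpose, Matrix.det_apply']
    refine Finset.sum_congr rfl fun σ _ => ?_
    rw [wordCount_zero]
    simp only [Matrix.transpose_apply, Matrix.of_apply, Finset.prod_ite_zero]
    simp
  | succ k ih =>
    rw [detG]
    simp only [← ih, wordCount_succ]
    rw [Finset.sum_comm]
    refine Finset.sum_congr rfl fun σ _ => ?_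
    push_cast
    rw [Finset.mul_sum]
    refine Finset.sum_congr rfl fun j _ => ?_
    congr 3
    funext i
    simp only [Pi.sub_apply]
    ring

lemma detG_perm (l k : ℕ) (v : Fin l → ℤ) (τ : Equiv.Perm (Fin l)) :
    detG l k (fun i => v (τ i)) = ((Equiv.Perm.sign τ : ℤˣ) : ℤ) * detG l k v := by
  induction k generalizing v with
  | zero =>
    simp only [detG]
    exact Matrix.det_permute τ
      (Matrix.of fun i j : Fin l => if 0 ≤ v i + ((j : ℕ) : ℤ) then (1 : ℤ) else 0)
  | succ k ih =>
    simp only [detG]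
    rw [Finset.mul_sum]
    refine Finset.sum_equiv τ (by simp) fun j _ => ?_
    rw [← ih]
    congr 1
    funext i
    simp [Pi.single_apply]

lemma detG_eq_zero_of_eq (l k : ℕ) (v : Fin l → ℤ) (a b : Fin l) (hab : a ≠ b) (h : v a = v b) :
    detG l k v = 0 := by
  have h1 := detG_perm l k v (Equiv.swap a b)
  have h2 : (fun i => v (Equiv.swap a b i)) = v := by
    funext i
    rw [Equiv.swap_apply_def]
    split_ifs with h3 h4
    · rw [h3, h]
    · rw [h4, h]
    · rfl
  rw [h2, Equiv.Perm.sign_swap hab] at h1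
  simp at h1
  linarith

lemma detG_eq_zero_of_neg (l k : ℕ) (v : Fin l → ℤ) (a : Fin l) (h : v a ≤ -l) :
    detG l k v = 0 := by
  induction k generalizing v with
  | zero =>
    rw [detG]
    apply Matrix.det_eq_zero_of_row_eq_zero a
    intro j
    have := j.2
    simp only [Matrix.of_apply]
    rw [if_neg]
    omega
  | succ k ih =>
    rw [detG]
    refine Finset.sum_eq_zero fun j _ => ih _ ?_
    simp only [Pi.sub_apply, Pi.single_apply]
    split_ifs <;> linarith

/-! ### Removing a corner -/

/-- remove the last cell of row `j` -/
def remCorner (μ : YoungDiagram) (j : ℕ) (h : μ.rowLen (j + 1) < μ.rowLen j) : YoungDiagram where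
  cells := μ.cells.erase (j, μ.rowLen j - 1)
  isLowerSet := by
    rintro ⟨a, b⟩ ⟨a', b'⟩ hle hm
    have hle' : a' ≤ a ∧ b' ≤ b := hle
    simp only [Finset.coe_erase, Set.mem_sdiff, Finset.mem_coe, YoungDiagram.mem_cells,
      Set.mem_singleton_iff, Prod.mk.injEq] at hm ⊢
    refine ⟨μ.up_left_mem hle'.1 hle'.2 hm.1, ?_⟩
    rintro ⟨rfl, rfl⟩
    have hb := hm.1
    rw [YoungDiagram.mem_iff_lt_rowLen] at hb
    rcases Nat.lt_or_ge a' a with h1 | h1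
    · have := μ.rowLen_anti (a' + 1) a h1
      omega
    · have : a = a' := by omega
      subst this
      apply hm.2
      constructor
      · rfl
      · omega

lemma mem_remCorner {μ : YoungDiagram} {j : ℕ} {h : μ.rowLen (j + 1) < μ.rowLen j} {p : ℕ × ℕ} :
    p ∈ remCorner μ j h ↔ p ∈ μ ∧ p ≠ (j, μ.rowLen j - 1) := by
  rw [← YoungDiagram.mem_cells, remCorner, Finset.mem_erase, YoungDiagram.mem_cells, and_comm]

lemma corner_mem {μ : YoungDiagram} {j : ℕ} (h : μ.rowLen (j + 1) < μ.rowLen j) :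
    (j, μ.rowLen j - 1) ∈ μ := by
  rw [YoungDiagram.mem_iff_lt_rowLen]; omega

lemma card_remCorner {μ : YoungDiagram} {j : ℕ} (h : μ.rowLen (j + 1) < μ.rowLen j) :
    (remCorner μ j h).card + 1 = μ.card :=
  Finset.card_erase_add_one ((YoungDiagram.mem_cells _).2 (corner_mem h))

lemma rowLen_remCorner {μ : YoungDiagram} {j : ℕ} (h : μ.rowLen (j + 1) < μ.rowLen j) (i : ℕ) :
    (remCorner μ j h).rowLen i = μ.rowLen i - if i = j then 1 else 0 := by
  have key : ∀ b, b < (remCorner μ j h).rowLen i ↔ b < μ.rowLen i - if i = j then 1 else 0 := by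
    intro b
    rw [← YoungDiagram.mem_iff_lt_rowLen, mem_remCorner, YoungDiagram.mem_iff_lt_rowLen]
    split_ifs with hi
    · subst hi
      simp only [ne_eq, Prod.mk.injEq, true_and]
      omega
    · simp [hi]
  have h1 := key ((remCorner μ j h).rowLen i)
  have h2 := key (μ.rowLen i - if i = j then 1 else 0)
  omega

lemma SYT.ext' {μ : YoungDiagram} {Q Q' : SYT μ} (h : ∀ i j, Q.entry i j = Q'.entry i j) :
    Q = Q' := by
  cases Q; cases Q'
  have : ‹ℕ → ℕ → ℕ› = ‹ℕ → ℕ → ℕ› := rfl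
  congr
  funext i j
  exact h i j

lemma SYT.entry_mem {μ : YoungDiagram} (Q : SYT μ) {i j : ℕ} (h : (i, j) ∈ μ) :
    1 ≤ Q.entry i j ∧ Q.entry i j ≤ μ.card := by
  have := Q.bijOn.mapsTo ((YoungDiagram.mem_cells _).2 h)
  simpa using this

lemma SYT.entry_le {μ : YoungDiagram} (Q : SYT μ) (i j : ℕ) : Q.entry i j ≤ μ.card := by
  by_cases h : (i, j) ∈ μ
  · exact (Q.entry_mem h).2
  · rw [Q.entry_eq_zero _ _ h]; omega

lemma SYT.inj {μ : YoungDiagram} (Q : SYT μ) {p q : ℕ × ℕ} (hp : p ∈ μ) (hq : q ∈ μ)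
    (h : Q.entry p.1 p.2 = Q.entry q.1 q.2) : p = q :=
  Q.bijOn.injOn ((YoungDiagram.mem_cells _).2 hp) ((YoungDiagram.mem_cells _).2 hq) h

lemma SYT.surj {μ : YoungDiagram} (Q : SYT μ) {k : ℕ} (h1 : 1 ≤ k) (h2 : k ≤ μ.card) :
    ∃ i j, (i, j) ∈ μ ∧ Q.entry i j = k := by
  obtain ⟨⟨i, j⟩, h, h'⟩ := Q.bijOn.surjOn (show k ∈ ↑(Finset.Icc 1 μ.card) by simp [h1, h2])
  exact ⟨i, j, (YoungDiagram.mem_cells _).1 h, h'⟩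

instance (μ : YoungDiagram) : Finite (SYT μ) := by
  refine Finite.of_injective
    (fun Q : SYT μ => fun p : μ.cells => (⟨Q.entry p.1.1 p.1.2, by
      have := Q.entry_le p.1.1 p.1.2; omega⟩ : Fin (μ.card + 1))) ?_
  intro Q Q' h
  apply SYT.ext'
  intro i j
  by_cases hm : (i, j) ∈ μ
  · have := congrFun h ⟨(i, j), (YoungDiagram.mem_cells _).2 hm⟩
    simpa using this
  · rw [Q.entry_eq_zero _ _ hm, Q'.entry_eq_zero _ _ hm]

/-- add the largest entry at a corner -/
def SYT.addCorner {μ : YoungDiagram} {j : ℕ} {h : μ.rowLen (j + 1) < μ.rowLen j}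
    (Q : SYT (remCorner μ j h)) : SYT μ where
  entry a b := if (a, b) = (j, μ.rowLen j - 1) then μ.card else Q.entry a b
  entry_eq_zero a b hab := by
    rw [if_neg, Q.entry_eq_zero]
    · rw [mem_remCorner]; tauto
    · intro he; rw [he] at hab; exact hab (corner_mem h)
  row_strict i j1 j2 hj hm := by
    have hc := card_remCorner h
    have hm' := hm
    rw [YoungDiagram.mem_iff_lt_rowLen] at hm'
    have h1 : (i, j1) ≠ (j, μ.rowLen j - 1) := by
      intro he
      simp only [Prod.mk.injEq] at he
      rw [he.1] at hm'
      omega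
    rw [if_neg h1]
    split_ifs with h2
    · have := Q.entry_le i j1
      omega
    · exact Q.row_strict i j1 j2 hj (mem_remCorner.2 ⟨hm, h2⟩)
  col_strict i1 i2 b hi hm := by
    have hc := card_remCorner h
    have hm' := hm
    rw [YoungDiagram.mem_iff_lt_rowLen] at hm'
    have h1 : (i1, b) ≠ (j, μ.rowLen j - 1) := by
      intro he
      simp only [Prod.mk.injEq] at he
      have := μ.rowLen_anti (j + 1) i2 (by omega)
      omega
    rw [if_neg h1]
    split_ifs with h2
    · have := Q.entry_le i1 b
      omega
    · exact Q.col_strict i1 i2 b hi (mem_remCorner.2 ⟨hm, h2⟩)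
  bijOn := by
    have hc := card_remCorner h
    refine ⟨?_, ?_, ?_⟩
    · rintro ⟨a, b⟩ hm
      rw [Finset.mem_coe, YoungDiagram.mem_cells] at hm
      rw [Finset.mem_coe, Finset.mem_Icc]
      dsimp only
      split_ifs with h1
      · omega
      · have := Q.entry_mem (mem_remCorner.2 ⟨hm, h1⟩)
        omega
    · rintro ⟨a, b⟩ hm ⟨a', b'⟩ hm' he
      rw [Finset.mem_coe, YoungDiagram.mem_cells] at hm hm'
      dsimp only at he
      split_ifs at he with h1 h2 h2
      · rw [h1, h2]
      · have := Q.entry_le a' b'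
        omega
      · have := Q.entry_le a b
        omega
      · exact Q.inj (p := (a, b)) (q := (a', b')) (mem_remCorner.2 ⟨hm, h1⟩)
          (mem_remCorner.2 ⟨hm', h2⟩) he
    · intro k hk
      rw [Finset.mem_coe, Finset.mem_Icc] at hk
      by_cases hk' : k = μ.card
      · refine ⟨(j, μ.rowLen j - 1), (YoungDiagram.mem_cells _).2 (corner_mem h), ?_⟩
        simp [hk']
      · obtain ⟨a, b, hm, he⟩ := Q.surj hk.1 (by omega)
        rw [mem_remCorner] at hm
        exact ⟨(a, b), (YoungDiagram.mem_cells _).2 hm.1, by dsimp only; rw [if_neg hm.2, he]⟩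

/-- delete the largest entry, at a corner -/
def SYT.delCorner {μ : YoungDiagram} {j : ℕ} (h : μ.rowLen (j + 1) < μ.rowLen j)
    (Q : SYT μ) (hQ : Q.entry j (μ.rowLen j - 1) = μ.card) : SYT (remCorner μ j h) where
  entry a b := if (a, b) = (j, μ.rowLen j - 1) then 0 else Q.entry a b
  entry_eq_zero a b hab := by
    split_ifs with h1
    · rfl
    · rw [Q.entry_eq_zero]
      intro hm
      exact hab (mem_remCorner.2 ⟨hm, h1⟩)
  row_strict i j1 j2 hj hm := by
    rw [mem_remCorner] at hm
    have := Q.row_strict i j1 j2 hj hm.1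
    rw [if_neg hm.2]
    split_ifs <;> omega
  col_strict i1 i2 b hi hm := by
    rw [mem_remCorner] at hm
    have := Q.col_strict i1 i2 b hi hm.1
    rw [if_neg hm.2]
    split_ifs <;> omega
  bijOn := by
    have hc := card_remCorner h
    refine ⟨?_, ?_, ?_⟩
    · rintro ⟨a, b⟩ hm
      rw [Finset.mem_coe, YoungDiagram.mem_cells, mem_remCorner] at hm
      rw [Finset.mem_coe, Finset.mem_Icc]
      dsimp only
      rw [if_neg hm.2]
      have h1 := Q.entry_mem hm.1
      have h2 : Q.entry a b ≠ μ.card := fun he =>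
        hm.2 (Q.inj (p := (a, b)) hm.1 (corner_mem h) (he.trans hQ.symm))
      omega
    · rintro ⟨a, b⟩ hm ⟨a', b'⟩ hm' he
      rw [Finset.mem_coe, YoungDiagram.mem_cells, mem_remCorner] at hm hm'
      dsimp only at he
      rw [if_neg hm.2, if_neg hm'.2] at he
      exact Q.inj (p := (a, b)) (q := (a', b')) hm.1 hm'.1 he
    · intro k hk
      rw [Finset.mem_coe, Finset.mem_Icc] at hk
      obtain ⟨a, b, hm, he⟩ := Q.surj hk.1 (by omega)
      have hne : (a, b) ≠ (j, μ.rowLen j - 1) := by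
        intro heq
        simp only [Prod.mk.injEq] at heq
        rw [heq.1, heq.2] at he
        omega
      exact ⟨(a, b), (YoungDiagram.mem_cells _).2 (mem_remCorner.2 ⟨hm, hne⟩), by
        dsimp only; rw [if_neg hne, he]⟩

lemma SYT.exists_corner {μ : YoungDiagram} (Q : SYT μ) (h : 0 < μ.card) :
    ∃ j, μ.rowLen (j + 1) < μ.rowLen j ∧ Q.entry j (μ.rowLen j - 1) = μ.card := by
  obtain ⟨a, b, hm, he⟩ := Q.surj h le_rfl
  have hm' := hm
  rw [YoungDiagram.mem_iff_lt_rowLen] at hm'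
  have hb : b = μ.rowLen a - 1 := by
    by_contra hne
    have h1 : (a, b + 1) ∈ μ := by rw [YoungDiagram.mem_iff_lt_rowLen]; omega
    have h2 := Q.row_strict a b (b + 1) (by omega) h1
    have h3 := Q.entry_le a (b + 1)
    omega
  refine ⟨a, ?_, by rw [← hb, he]⟩
  by_contra hne
  have h1 : (a + 1, b) ∈ μ := by rw [YoungDiagram.mem_iff_lt_rowLen]; omega
  have h2 := Q.col_strict a (a + 1) b (by omega) h1
  have h3 := Q.entry_le (a + 1) b
  omega

lemma fSYTRow_succ (l : ℕ) (μ : YoungDiagram) (hl : μ.rowLen l = 0) (t : ℕ) (ht : t < μ.card) :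
    fSYTRow μ t = ∑ j : Fin l, if h : μ.rowLen (j + 1) < μ.rowLen j then
      fSYTRow (remCorner μ j h) t else 0 := by
  have h1 : ∀ j : Fin l, (if h : μ.rowLen (j + 1) < μ.rowLen j then
      fSYTRow (remCorner μ j h) t else 0) =
      Nat.card (Σ h : PLift (μ.rowLen (j + 1) < μ.rowLen j), {Q : SYT (remCorner μ j h.down) //
        ∀ k, 1 ≤ k → k ≤ t → ∃ b, (0, b) ∈ remCorner μ j h.down ∧ Q.entry 0 b = k}) := by
    intro j
    split_ifs with h
    · unfold fSYTRow
      refine Nat.card_congr ⟨fun Q => ⟨⟨h⟩, Q⟩, fun x => x.2, fun _ => rfl, fun x => rfl⟩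
    · symm
      rw [Nat.card_eq_zero]
      left
      exact ⟨fun x => h x.1.down⟩
  simp only [h1]
  rw [← Nat.card_sigma]
  symm
  unfold fSYTRow
  refine Nat.card_congr (Equiv.ofBijective (fun x => ⟨x.2.2.1.addCorner, ?_⟩) ⟨?_, ?_⟩)
  · intro k hk1 hk2
    obtain ⟨b, hb1, hb2⟩ := x.2.2.2 k hk1 hk2
    rw [mem_remCorner] at hb1
    refine ⟨b, hb1.1, ?_⟩
    change (if _ then _ else _) = _
    rw [if_neg hb1.2, hb2]
  · rintro ⟨j, ⟨h⟩, Q, hQ⟩ ⟨j', ⟨h'⟩, Q', hQ'⟩ he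
    have he' : ∀ a b, Q.addCorner.entry a b = Q'.addCorner.entry a b := by
      intro a b
      have h0 : Q.addCorner = Q'.addCorner := congrArg Subtype.val he
      rw [h0]
    have e1 : Q.addCorner.entry j (μ.rowLen j - 1) = μ.card := by
      change (if _ then _ else _) = _
      rw [if_pos rfl]
    have e2 : Q'.addCorner.entry j' (μ.rowLen j' - 1) = μ.card := by
      change (if _ then _ else _) = _
      rw [if_pos rfl]
    have hj : j = j' := by
      have := Q'.addCorner.inj (corner_mem h) (corner_mem h')
        ((he' _ _).symm.trans (e1.trans e2.symm))
      simp only [Prod.mk.injEq] at this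
      exact Fin.ext this.1
    subst hj
    have hQQ : Q = Q' := by
      apply SYT.ext'
      intro a b
      by_cases hc : (a, b) = ((j : ℕ), μ.rowLen j - 1)
      · have hn : (a, b) ∉ remCorner μ j h := by rw [mem_remCorner]; tauto
        rw [Q.entry_eq_zero _ _ hn, Q'.entry_eq_zero _ _ hn]
      · have := he' a b
        change (if _ then _ else _) = (if _ then _ else _) at this
        rwa [if_neg hc, if_neg hc] at this
    subst hQQ
    rfl
  · rintro ⟨Q, hQ⟩
    obtain ⟨j, hj, he⟩ := Q.exists_corner (by omega)
    have hjl : j < l := by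
      by_contra hne
      have := μ.rowLen_anti l j (by omega)
      omega
    refine ⟨⟨⟨j, hjl⟩, ⟨hj⟩, Q.delCorner hj he, ?_⟩, ?_⟩
    · intro k hk1 hk2
      obtain ⟨b, hb, hbe⟩ := hQ k hk1 hk2
      have hne : (0, b) ≠ (j, μ.rowLen j - 1) := by
        intro heq
        simp only [Prod.mk.injEq] at heq
        rw [← heq.2, ← heq.1] at he
        omega
      refine ⟨b, mem_remCorner.2 ⟨hb, hne⟩, ?_⟩
      change (if _ then _ else _) = _
      rw [if_neg hne, hbe]
    · apply Subtype.ext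
      apply SYT.ext'
      intro a b
      change (if _ then _ else if _ then _ else _) = _
      by_cases hc : (a, b) = (j, μ.rowLen j - 1)
      · rw [if_pos hc]
        simp only [Prod.mk.injEq] at hc
        rw [hc.1, hc.2, he]
      · rw [if_neg hc, if_neg hc]

lemma card_of_one_row {μ : YoungDiagram} (h : μ.rowLen 1 = 0) : μ.card = μ.rowLen 0 := by
  rw [YoungDiagram.rowLen_eq_card]
  have : μ.row 0 = μ.cells := by
    ext ⟨a, b⟩
    rw [YoungDiagram.mem_row_iff, YoungDiagram.mem_cells]
    refine ⟨fun h => h.1, fun hm => ⟨hm, ?_⟩⟩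
    by_contra hne
    have h1 := μ.rowLen_anti 1 a (by simp at hne; omega)
    rw [YoungDiagram.mem_iff_lt_rowLen] at hm
    omega
  rw [this]

lemma row_zero_of_one_row {μ : YoungDiagram} (h : μ.rowLen 1 = 0) {a b : ℕ} (hm : (a, b) ∈ μ) :
    a = 0 := by
  by_contra hne
  have h1 := μ.rowLen_anti 1 a (by omega)
  rw [YoungDiagram.mem_iff_lt_rowLen] at hm
  omega

/-- the one-row tableau -/
noncomputable def oneRowSYT (μ : YoungDiagram) (h : μ.rowLen 1 = 0) : SYT μ where
  entry a b := if (a, b) ∈ μ then b + 1 else 0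
  entry_eq_zero a b hab := if_neg hab
  row_strict i j1 j2 hj hm := by
    rw [if_pos hm]
    split_ifs <;> omega
  col_strict i1 i2 j hi hm := by
    have := row_zero_of_one_row h hm
    omega
  bijOn := by
    have hc := card_of_one_row h
    refine ⟨?_, ?_, ?_⟩
    · rintro ⟨a, b⟩ hm
      rw [Finset.mem_coe, YoungDiagram.mem_cells] at hm
      rw [Finset.mem_coe, Finset.mem_Icc]
      dsimp only
      rw [if_pos hm]
      have := row_zero_of_one_row h hm
      subst this
      rw [YoungDiagram.mem_iff_lt_rowLen] at hm
      omega
    · rintro ⟨a, b⟩ hm ⟨a', b'⟩ hm' he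
      rw [Finset.mem_coe, YoungDiagram.mem_cells] at hm hm'
      dsimp only at he
      rw [if_pos hm, if_pos hm'] at he
      have h1 := row_zero_of_one_row h hm
      have h2 := row_zero_of_one_row h hm'
      subst h1; subst h2
      have : b = b' := by omega
      rw [this]
    · intro k hk
      rw [Finset.mem_coe, Finset.mem_Icc] at hk
      have hm : (0, k - 1) ∈ μ := by rw [YoungDiagram.mem_iff_lt_rowLen]; omega
      refine ⟨(0, k - 1), (YoungDiagram.mem_cells _).2 hm, ?_⟩
      dsimp only
      rw [if_pos hm]
      omega

lemma SYT.one_row_entry {μ : YoungDiagram} (h : μ.rowLen 1 = 0) (Q : SYT μ) (b : ℕ)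
    (hm : (0, b) ∈ μ) : Q.entry 0 b = b + 1 := by
  have hc := card_of_one_row h
  have lower : ∀ b, (0, b) ∈ μ → b + 1 ≤ Q.entry 0 b := by
    intro b
    induction b with
    | zero => intro hm; exact (Q.entry_mem hm).1
    | succ b ih =>
      intro hm
      have h1 := ih (μ.up_left_mem le_rfl (by omega) hm)
      have h2 := Q.row_strict 0 b (b + 1) (by omega) hm
      omega
  have upper : ∀ d b, b + d + 1 = μ.rowLen 0 → Q.entry 0 b ≤ b + 1 := by
    intro d
    induction d with
    | zero => intro b hb; have := Q.entry_le 0 b; omega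
    | succ d ih =>
      intro b hb
      have h1 := ih (b + 1) (by omega)
      have h2 := Q.row_strict 0 b (b + 1) (by omega)
        (by rw [YoungDiagram.mem_iff_lt_rowLen]; omega)
      omega
  have h1 := lower b hm
  rw [YoungDiagram.mem_iff_lt_rowLen] at hm
  have h2 := upper (μ.rowLen 0 - 1 - b) b (by omega)
  omega

lemma fSYTRow_card (μ : YoungDiagram) :
    fSYTRow μ μ.card = if μ.rowLen 1 = 0 then 1 else 0 := by
  unfold fSYTRow
  split_ifs with h
  · rw [Nat.card_eq_one_iff_unique]
    refine ⟨⟨?_⟩, ⟨⟨oneRowSYT μ h, ?_⟩⟩⟩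
    · rintro ⟨Q, _⟩ ⟨Q', _⟩
      apply Subtype.ext
      apply SYT.ext'
      intro a b
      by_cases hm : (a, b) ∈ μ
      · have := row_zero_of_one_row h hm
        subst this
        rw [Q.one_row_entry h b hm, Q'.one_row_entry h b hm]
      · rw [Q.entry_eq_zero _ _ hm, Q'.entry_eq_zero _ _ hm]
    · intro k hk1 hk2
      obtain ⟨a, b, hm, he⟩ := (oneRowSYT μ h).surj hk1 hk2
      have := row_zero_of_one_row h hm
      subst this
      exact ⟨b, hm, he⟩
  · rw [Nat.card_eq_zero]
    left
    refine ⟨fun Q => ?_⟩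
    have hm : (1, 0) ∈ μ := by rw [YoungDiagram.mem_iff_lt_rowLen]; omega
    have h1 := Q.1.entry_mem hm
    obtain ⟨b, hb, he⟩ := Q.2 _ h1.1 h1.2
    have := Q.1.inj (p := (0, b)) (q := (1, 0)) hb hm he
    simp at this

lemma detG_base (l : ℕ) (μ : YoungDiagram) (hl : μ.rowLen l = 0) :
    detG l 0 (fun i => ((μ.rowLen (i : ℕ) : ℕ) : ℤ) - ((i : ℕ) : ℤ)) =
      if μ.rowLen 1 = 0 then 1 else 0 := by
  rw [detG]
  split_ifs with h
  · rw [Matrix.det_of_isUpperTriangular]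
    · apply Finset.prod_eq_one
      intro i _
      simp only [Matrix.of_apply]
      rw [if_pos (by omega)]
    · intro i j hij
      have hij' : (j : ℕ) < i := hij
      have := μ.rowLen_anti 1 i (by omega)
      simp only [Matrix.of_apply]
      rw [if_neg (by omega)]
  · have h2 : 1 < l := by
      by_contra hne
      have := μ.rowLen_anti l 1 (by omega)
      omega
    have := μ.rowLen_anti 0 1 (by omega)
    apply Matrix.det_zero_of_row_eq (i := ⟨0, (by omega : 0 < l)⟩) (j := ⟨1, h2⟩)
      (by simp [Fin.ext_iff])
    funext j
    simp only [Matrix.of_apply]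
    rw [if_pos (by push_cast; omega), if_pos (by push_cast; omega)]

lemma detG_eq_fSYTRow (l k : ℕ) (μ : YoungDiagram) (hl : μ.rowLen l = 0) (hk : k ≤ μ.card) :
    detG l k (fun i => ((μ.rowLen (i : ℕ) : ℕ) : ℤ) - ((i : ℕ) : ℤ)) = fSYTRow μ (μ.card - k) := by
  induction k generalizing μ with
  | zero =>
    rw [detG_base l μ hl, Nat.sub_zero, fSYTRow_card]
    split_ifs <;> rfl
  | succ k ih =>
    rw [detG, fSYTRow_succ l μ hl _ (by omega)]
    push_cast
    refine Finset.sum_congr rfl fun j _ => ?_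
    split_ifs with h
    · have hc := card_remCorner h
      have e : μ.card - (k + 1) = (remCorner μ j h).card - k := by omega
      rw [e, ← ih _ (by rw [rowLen_remCorner, hl]; simp) (by omega)]
      congr 1
      funext i
      simp only [Pi.sub_apply, Pi.single_apply, rowLen_remCorner, Fin.ext_iff]
      split_ifs with hi
      · rw [hi]
        omega
      · simp
    · rw [Nat.cast_zero]
      have ha := μ.rowLen_anti j (j + 1) (by omega)
      by_cases hjl : (j : ℕ) + 1 < l
      · apply detG_eq_zero_of_eq l k _ j ⟨j + 1, hjl⟩
        · intro he
          have := congrArg Fin.val he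
          simp at this
        · simp only [Pi.sub_apply, Pi.single_apply, Fin.ext_iff]
          push_cast
          simp
          omega
      · have hj : (j : ℕ) + 1 = l := by omega
        rw [hj, hl] at h
        apply detG_eq_zero_of_neg l k _ j
        simp only [Pi.sub_apply, Pi.single_apply]
        simp
        omega

lemma length_rowLens_row (μ : YoungDiagram) : μ.rowLen μ.rowLens.length = 0 := by
  rw [YoungDiagram.length_rowLens]
  by_contra h
  have : (μ.colLen 0, 0) ∈ μ := by rw [YoungDiagram.mem_iff_lt_rowLen]; omega
  rw [YoungDiagram.mem_iff_lt_colLen] at this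
  omega

lemma sum_rowLen (μ : YoungDiagram) (l : ℕ) (hl : μ.rowLen l = 0) :
    ∑ i : Fin l, μ.rowLen i = μ.card := by
  rw [Fin.sum_univ_eq_sum_range (fun i => μ.rowLen i) l]
  have := Finset.card_eq_sum_card_fiberwise (s := μ.cells) (t := Finset.range l) (f := Prod.fst)
    (by
      rintro ⟨a, b⟩ hm
      rw [Finset.mem_coe, YoungDiagram.mem_cells, YoungDiagram.mem_iff_lt_rowLen] at hm
      simp only [Finset.coe_range, Set.mem_Iio]
      by_contra hne
      have := μ.rowLen_anti l a (by omega)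
      omega)
  refine Eq.trans ?_ this.symm
  refine Finset.sum_congr rfl fun i _ => ?_
  rw [YoungDiagram.rowLen_eq_card]
  rfl

lemma fixedYoungFns_inv (n l : ℕ) (c : Fin l → ℤ) (g : Equiv.Perm (Fin n)) :
    fixedYoungFns n l c g⁻¹ = fixedYoungFns n l c g := by
  unfold fixedYoungFns
  refine Nat.card_congr (Equiv.subtypeEquivRight fun f => and_congr_left fun _ => ?_)
  constructor
  · intro h x
    have := h (g x)
    simpa using this.symm
  · intro h x
    have := h (g⁻¹ x)
    simpa using this.symm

lemma sum_fixEmb_chi (n k : ℕ) (μ : YoungDiagram) (hμ : μ.card = n) (hk : k ≤ n) :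
    ∑ g : Equiv.Perm (Fin n), (fixEmb n k g : ℤ) * chi n μ g⁻¹
      = (fSYTRow μ (n - k) : ℤ) * (n.factorial : ℤ) := by
  have hl := length_rowLens_row μ
  rw [← hμ, ← detG_eq_fSYTRow μ.rowLens.length k μ hl (by omega), ← sum_wordCount, hμ]
  unfold chi
  simp only [Finset.mul_sum, Finset.sum_mul]
  rw [Finset.sum_comm]
  refine Finset.sum_congr rfl fun σ _ => ?_
  rw [mul_assoc, ← Nat.cast_mul, ← burnside_count]
  · push_cast
    rw [Finset.mul_sum]
    refine Finset.sum_congr rfl fun g _ => ?_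
    rw [fixedYoungFns_inv]
    ring
  · rw [Finset.sum_add_distrib, Finset.sum_sub_distrib]
    have h1 : ∑ i : Fin μ.rowLens.length, (((σ i : Fin _) : ℕ) : ℤ)
        = ∑ i : Fin μ.rowLens.length, ((i : ℕ) : ℤ) :=
      Equiv.sum_comp σ (fun i => ((i : ℕ) : ℤ))
    rw [h1, sub_add_cancel, ← hμ, ← sum_rowLen μ _ hl]
    push_cast
    rfl

/-! ### Signed chain counts -/

/-- chains contained in a finset -/
noncomputable def chainsOf {V : Type*} [PartialOrder V] (A : Finset V) : Finset (Finset V) :=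
  A.powerset.filter (fun C => IsChain (· ≤ ·) (C : Set V))

lemma mem_chainsOf {V : Type*} [PartialOrder V] {A C : Finset V} :
    C ∈ chainsOf A ↔ C ⊆ A ∧ IsChain (· ≤ ·) (C : Set V) := by
  simp [chainsOf]

/-- signed number of chains -/
noncomputable def chE {V : Type*} [PartialOrder V] (A : Finset V) : ℤ :=
  ∑ C ∈ chainsOf A, (-1) ^ C.card

lemma chE_rec {V : Type*} [PartialOrder V] (A : Finset V) :
    chE A = 1 - ∑ x ∈ A, chE (A.filter (· < x)) := by
  unfold chE
  have h0 : (∅ : Finset V) ∈ chainsOf A := by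
    rw [mem_chainsOf]; simp
  rw [← Finset.add_sum_erase _ _ h0]
  simp only [Finset.card_empty, pow_zero]
  rw [sub_eq_add_neg, ← Finset.sum_neg_distrib]
  congr 1
  simp only [← Finset.sum_neg_distrib]
  rw [Finset.sum_sigma']
  symm
  refine Finset.sum_bij (fun p _ => insert p.1 p.2) ?_ ?_ ?_ ?_
  · rintro ⟨x, D⟩ hp
    simp only [Finset.mem_sigma, mem_chainsOf] at hp
    rw [Finset.mem_erase, mem_chainsOf]
    refine ⟨Finset.insert_ne_empty _ _, ?_, ?_⟩
    · intro y hy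
      rcases Finset.mem_insert.1 hy with rfl | hy
      · exact hp.1
      · exact (Finset.mem_filter.1 (hp.2.1 hy)).1
    · rw [Finset.coe_insert]
      refine hp.2.2.insert fun y hy _ => Or.inr ?_
      exact (Finset.mem_filter.1 (hp.2.1 hy)).2.le
  · rintro ⟨x, D⟩ hp ⟨x', D'⟩ hp' he
    simp only [Finset.mem_sigma, mem_chainsOf] at hp hp' he
    have hD : ∀ y ∈ D, y < x := fun y hy => (Finset.mem_filter.1 (hp.2.1 hy)).2
    have hD' : ∀ y ∈ D', y < x' := fun y hy => (Finset.mem_filter.1 (hp'.2.1 hy)).2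
    have hx : x = x' := by
      have h1 : x ∈ insert x' D' := he ▸ Finset.mem_insert_self _ _
      have h2 : x' ∈ insert x D := he ▸ Finset.mem_insert_self _ _
      rcases Finset.mem_insert.1 h1 with h | h
      · exact h
      · rcases Finset.mem_insert.1 h2 with h' | h'
        · exact h'.symm
        · exact absurd ((hD' _ h).trans (hD _ h')) (lt_irrefl _)
    subst hx
    have hxD : x ∉ D := fun h => lt_irrefl _ (hD _ h)
    have hxD' : x ∉ D' := fun h => lt_irrefl _ (hD' _ h)
    have : D = D' := by
      rw [← Finset.erase_insert hxD, he, Finset.erase_insert hxD']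
    rw [this]
  · intro C hC
    rw [Finset.mem_erase, mem_chainsOf] at hC
    obtain ⟨x, hx⟩ := C.exists_maximal (Finset.nonempty_iff_ne_empty.2 hC.1)
    have hlt : ∀ y ∈ C.erase x, y < x := by
      intro y hy
      rw [Finset.mem_erase] at hy
      rcases hC.2.2 (Finset.mem_coe.2 hy.2) (Finset.mem_coe.2 hx.1) hy.1 with h | h
      · exact lt_of_le_of_ne h hy.1
      · exact absurd (le_antisymm (hx.2 hy.2 h) h) hy.1
    refine ⟨⟨x, C.erase x⟩, ?_, Finset.insert_erase hx.1⟩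
    simp only [Finset.mem_sigma, mem_chainsOf]
    refine ⟨hC.2.1 hx.1, ?_, hC.2.2.mono (by simp)⟩
    intro y hy
    exact Finset.mem_filter.2 ⟨hC.2.1 (Finset.mem_of_mem_erase hy), hlt y hy⟩
  · rintro ⟨x, D⟩ hp
    simp only [Finset.mem_sigma, mem_chainsOf] at hp
    have hxD : x ∉ D := fun h => lt_irrefl _ (Finset.mem_filter.1 (hp.2.1 h)).2
    rw [Finset.card_insert_of_notMem hxD, pow_succ]
    ring

/-! ### Words -/

lemma cword_ext {n r : ℕ} {u v : CInjWord n r} (h : u.1 = v.1) : u = v := Subtype.ext h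

/-- constructor of words -/
def mkW {n r : ℕ} (l : List (Fin n × ZMod r)) (h : (l.map Prod.fst).Nodup) : CInjWord n r := ⟨l, h⟩

instance (n r : ℕ) [NeZero r] : Finite (CInjWord n r) := by
  refine Finite.of_injective
    (fun w : CInjWord n r => (⟨w.1, List.Nodup.of_map _ w.2⟩ : {l : List (Fin n × ZMod r) // l.Nodup})) ?_
  intro a b h
  have h' : a.1 = b.1 := congrArg (fun z => z.1) h
  exact cword_ext h'

noncomputable instance (n r : ℕ) [NeZero r] : Fintype (CInjWord n r) := Fintype.ofFinite _

/-- length of a word -/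
def wlen {n r : ℕ} (w : CInjWord n r) : ℕ := w.1.length

lemma cword_le {n r : ℕ} {u v : CInjWord n r} : u ≤ v ↔ u.1.Sublist v.1 := Iff.rfl

lemma wlen_mono {n r : ℕ} {u v : CInjWord n r} (h : u ≤ v) : wlen u ≤ wlen v :=
  List.Sublist.length_le h

lemma eq_of_le_wlen {n r : ℕ} {u v : CInjWord n r} (h : u ≤ v) (h' : wlen v ≤ wlen u) : u = v :=
  Subtype.ext (List.Sublist.eq_of_length_le h h')

lemma wlen_lt {n r : ℕ} {u v : CInjWord n r} (h : u < v) : wlen u < wlen v := by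
  by_contra hne
  exact h.ne (eq_of_le_wlen h.le (by omega))

lemma map_eq_self_iff' {α : Type*} (f : α → α) (l : List α) : l.map f = l ↔ ∀ x ∈ l, f x = x := by
  conv_lhs => rhs; rw [← List.map_id l]
  rw [List.map_inj_left]
  rfl

lemma permC_fixed_iff {n r : ℕ} (g : Equiv.Perm (Fin n)) (w : CInjWord n r) :
    permCWord g w = w ↔ ∀ p ∈ w.1, g p.1 = p.1 := by
  have h1 : permCWord g w = w ↔ w.1.map (fun p => (g p.1, p.2)) = w.1 :=
    ⟨fun h => congrArg (fun z : CInjWord n r => z.1) h, fun h => cword_ext h⟩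
  rw [h1, map_eq_self_iff']
  simp [Prod.ext_iff]

lemma permC_fixed_of_le {n r : ℕ} {g : Equiv.Perm (Fin n)} {u w : CInjWord n r} (h : u ≤ w)
    (hw : permCWord g w = w) : permCWord g u = u := by
  rw [permC_fixed_iff] at hw ⊢
  exact fun p hp => hw p (List.Sublist.subset h hp)

lemma wlen_permC {n r : ℕ} (g : Equiv.Perm (Fin n)) (w : CInjWord n r) :
    wlen (permCWord g w) = wlen w := by
  simp [wlen, permCWord]

lemma sum_sublists {α : Type*} (l : List α) (hl : l ≠ []) :
    ((l.sublists').map (fun s => (-1 : ℤ) ^ s.length)).sum = 0 := by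
  cases l with
  | nil => exact absurd rfl hl
  | cons a t =>
    rw [List.sublists'_cons, List.map_append, List.sum_append, List.map_map]
    have : ((fun s : List α => (-1 : ℤ) ^ s.length) ∘ List.cons a)
        = fun s => (-1) * ((-1 : ℤ) ^ s.length) := by
      funext s
      simp [pow_succ]
    rw [this, List.sum_map_mul_left]
    ring

lemma sum_below {n r : ℕ} [NeZero r] (x : CInjWord n r) (hx : 1 ≤ wlen x) :
    ∑ y ∈ Finset.univ.filter (fun y => y ≤ x), (-1 : ℤ) ^ wlen y = 0 := by
  have hnd : x.1.Nodup := List.Nodup.of_map _ x.2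
  have h0 := sum_sublists x.1 (by intro h; simp [wlen, h] at hx)
  rw [← h0, ← List.sum_toFinset _ (List.nodup_sublists'.2 hnd)]
  refine Finset.sum_bij (fun y _ => y.1) ?_ ?_ ?_ ?_
  · intro y hy
    rw [Finset.mem_filter] at hy
    rw [List.mem_toFinset, List.mem_sublists']
    exact hy.2
  · intro y _ y' _ h
    exact Subtype.ext h
  · intro s hs
    simp only [List.mem_toFinset, List.mem_sublists'] at hs
    refine ⟨mkW s (List.Nodup.sublist (hs.map _) x.2), ?_, rfl⟩
    rw [Finset.mem_filter]
    exact ⟨Finset.mem_univ _, hs⟩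
  · intro y _; rfl

/-- fixed words of length between `1` and `m` -/
noncomputable def fixW (n r : ℕ) [NeZero r] (g : Equiv.Perm (Fin n)) (m : ℕ) :
    Finset (CInjWord n r) :=
  Finset.univ.filter (fun w => (1 ≤ wlen w ∧ wlen w ≤ m) ∧ permCWord g w = w)

lemma mem_fixW {n r : ℕ} [NeZero r] {g : Equiv.Perm (Fin n)} {m : ℕ} {w : CInjWord n r} :
    w ∈ fixW n r g m ↔ (1 ≤ wlen w ∧ wlen w ≤ m) ∧ permCWord g w = w := by
  simp [fixW]

lemma bot_wlen {n r : ℕ} : wlen (⊥ : CInjWord n r) = 0 := rfl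

lemma eq_bot_of_wlen {n r : ℕ} {w : CInjWord n r} (h : wlen w = 0) : w = ⊥ :=
  (eq_of_le_wlen bot_le (by omega)).symm

lemma chE_below (n r : ℕ) [NeZero r] (g : Equiv.Perm (Fin n)) (m : ℕ) :
    ∀ (k : ℕ) (x : CInjWord n r), wlen x = k → x ∈ fixW n r g m →
      chE ((fixW n r g m).filter (· < x)) = - (-1) ^ wlen x := by
  intro k
  induction k using Nat.strong_induction_on with
  | _ k ih =>
    intro x hxk hx
    have hx' := hx
    rw [mem_fixW] at hx'
    rw [chE_rec]
    have h1 : ∀ y ∈ (fixW n r g m).filter (· < x),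
        chE (((fixW n r g m).filter (· < x)).filter (· < y)) = - (-1) ^ wlen y := by
      intro y hy
      rw [Finset.mem_filter] at hy
      rw [← ih (wlen y) (by have := wlen_lt hy.2; omega) y rfl hy.1]
      congr 1
      ext z
      simp only [Finset.mem_filter]
      constructor
      · rintro ⟨⟨h1, _⟩, h2⟩; exact ⟨h1, h2⟩
      · rintro ⟨h1, h2⟩; exact ⟨⟨h1, h2.trans hy.2⟩, h2⟩
    rw [Finset.sum_congr rfl h1]
    have h2 : Finset.univ.filter (fun y => y ≤ x)
        = insert ⊥ (insert x ((fixW n r g m).filter (· < x))) := by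
      ext y
      simp only [Finset.mem_filter, Finset.mem_univ, true_and, Finset.mem_insert, mem_fixW]
      constructor
      · intro h
        by_cases h3 : wlen y = 0
        · exact Or.inl (eq_bot_of_wlen h3)
        · right
          rcases h.eq_or_lt with h4 | h4
          · exact Or.inl h4
          · right
            have := wlen_lt h4
            exact ⟨⟨⟨by omega, by omega⟩, permC_fixed_of_le h hx'.2⟩, h4⟩
      · rintro (rfl | rfl | h)
        · exact bot_le
        · exact le_rfl
        · exact h.2.le
    have h3 := sum_below x hx'.1.1
    rw [h2, Finset.sum_insert, Finset.sum_insert, bot_wlen] at h3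
    · rw [Finset.sum_neg_distrib]
      linarith
    · simp
    · simp only [Finset.mem_insert, Finset.mem_filter, mem_fixW, bot_wlen]
      rintro (h | h)
      · rw [← h, bot_wlen] at hx'; omega
      · omega

lemma card_fixW_len (n r : ℕ) [NeZero r] (g : Equiv.Perm (Fin n)) (k : ℕ) :
    (Finset.univ.filter (fun w : CInjWord n r => wlen w = k ∧ permCWord g w = w)).card
      = r ^ k * fixEmb n k g := by
  rw [← Fintype.card_subtype, ← Nat.card_eq_fintype_card]
  have hr : Nat.card (Fin k → ZMod r) = r ^ k := by
    simp [ZMod.card]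
  rw [← hr, mul_comm]
  unfold fixEmb
  rw [← Nat.card_prod]
  symm
  refine Nat.card_congr (Equiv.ofBijective (fun p =>
    ⟨mkW (List.ofFn (fun i => (p.1.1 i, p.2 i))) ?_, ?_, ?_⟩) ⟨?_, ?_⟩)
  · rw [List.map_ofFn, List.nodup_ofFn]
    exact p.1.1.injective
  · simp [wlen, mkW]
  · rw [permC_fixed_iff]
    intro q hq
    rw [mkW, List.mem_ofFn] at hq
    obtain ⟨i, rfl⟩ := hq
    exact p.1.2 i
  · rintro ⟨⟨a, ha⟩, c⟩ ⟨⟨a', ha'⟩, c'⟩ h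
    have h1 := List.ofFn_injective (congrArg (fun z => z.1.1) h)
    have h2 : a = a' := by
      ext i
      exact congrArg Fin.val (congrArg Prod.fst (congrFun h1 i))
    have h3 : c = c' := by
      funext i
      exact congrArg Prod.snd (congrFun h1 i)
    subst h2; subst h3; rfl
  · rintro ⟨w, hk, hw⟩
    subst hk
    rw [permC_fixed_iff] at hw
    refine ⟨⟨⟨⟨fun i : Fin w.1.length => (w.1.get i).1, ?_⟩, ?_⟩,
      fun i : Fin w.1.length => (w.1.get i).2⟩, ?_⟩
    · have := w.2
      rw [← List.ofFn_get w.1, List.map_ofFn, List.nodup_ofFn] at this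
      exact this
    · intro i
      exact hw _ (List.get_mem _ _)
    · apply Subtype.ext
      apply Subtype.ext
      exact List.ofFn_get w.1

lemma chE_fixW (n r : ℕ) [NeZero r] (g : Equiv.Perm (Fin n)) (m : ℕ) :
    chE (fixW n r g m) = ∑ k ∈ Finset.range (m + 1), (-1) ^ k * ((r ^ k * fixEmb n k g : ℕ) : ℤ) := by
  rw [chE_rec, Finset.sum_congr rfl (fun x hx => chE_below n r g m _ x rfl hx),
    Finset.sum_neg_distrib, sub_neg_eq_add, Finset.sum_range_succ']
  have h0 : fixEmb n 0 g = 1 := by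
    unfold fixEmb
    rw [Nat.card_eq_one_iff_unique]
    exact ⟨⟨fun a b => Subtype.ext (by ext i; exact i.elim0)⟩,
      ⟨⟨⟨Fin.elim0, fun i => i.elim0⟩, fun i => i.elim0⟩⟩⟩
  rw [h0, add_comm]
  simp only [pow_zero, Nat.cast_mul, Nat.cast_one, mul_one]
  congr 1
  rw [← Finset.sum_fiberwise_of_maps_to (s := fixW n r g m) (t := (Finset.range m).image (· + 1))
    (g := wlen)]
  · rw [Finset.sum_image (by intro a _ b _ h; simpa using h)]
    refine Finset.sum_congr rfl fun k hk => ?_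
    rw [Finset.mem_range] at hk
    have e : (fixW n r g m).filter (fun w => wlen w = k + 1) =
        Finset.univ.filter (fun w : CInjWord n r => wlen w = k + 1 ∧ permCWord g w = w) := by
      ext w
      simp only [Finset.mem_filter, mem_fixW, Finset.mem_univ, true_and]
      constructor
      · rintro ⟨⟨_, h⟩, h'⟩; exact ⟨h', h⟩
      · rintro ⟨h, h'⟩; exact ⟨⟨⟨by omega, by omega⟩, h'⟩, h⟩
    rw [Finset.sum_congr rfl (g := fun _ => (-1 : ℤ) ^ (k + 1))
      (fun w hw => by rw [(Finset.mem_filter.1 hw).2]), Finset.sum_const, e, card_fixW_len]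
    rw [nsmul_eq_mul]
    push_cast
    ring
  · intro w hw
    rw [mem_fixW] at hw
    rw [Finset.mem_image]
    exact ⟨wlen w - 1, by rw [Finset.mem_range]; omega, by omega⟩

/-! ### Maximal chains -/

lemma sublist_interp {α : Type*} {x y : List α} (h : x.Sublist y) :
    ∀ t, x.length ≤ t → t ≤ y.length → ∃ z, x.Sublist z ∧ z.Sublist y ∧ z.length = t := by
  induction h with
  | slnil => intro t h1 h2; exact ⟨[], by simp, by simp, by simp at h2; simp [h2]⟩
  | @cons x y a h ih =>
    intro t h1 h2
    by_cases ht : t ≤ y.length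
    · obtain ⟨z, hz1, hz2, hz3⟩ := ih t h1 ht
      exact ⟨z, hz1, hz2.cons a, hz3⟩
    · simp at h2
      exact ⟨a :: y, h.cons a, List.Sublist.refl _, by simp; omega⟩
  | @cons_cons x y a h ih =>
    intro t h1 h2
    simp at h1 h2
    obtain ⟨z, hz1, hz2, hz3⟩ := ih (t - 1) (by omega) (by omega)
    exact ⟨a :: z, List.Sublist.cons_cons a hz1, List.Sublist.cons_cons a hz2, by simp; omega⟩

lemma word_interp {n r : ℕ} {x y : CInjWord n r} (h : x ≤ y) (t : ℕ) (h1 : wlen x ≤ t)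
    (h2 : t ≤ wlen y) : ∃ z : CInjWord n r, x ≤ z ∧ z ≤ y ∧ wlen z = t := by
  obtain ⟨z, hz1, hz2, hz3⟩ := sublist_interp (cword_le.1 h) t h1 h2
  exact ⟨mkW z (List.Nodup.sublist (hz2.map _) y.2), hz1, hz2, hz3⟩

lemma word_extend {n r : ℕ} (x : CInjWord n r) : ∃ y : CInjWord n r, x ≤ y ∧ wlen y = n := by
  let M : List (Fin n) := (Finset.univ.filter (fun i => i ∉ x.1.map Prod.fst)).toList
  have hM : ∀ i, i ∈ M ↔ i ∉ x.1.map Prod.fst := by intro i; simp [M]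
  have hmap : (x.1 ++ M.map (fun i => (i, (0 : ZMod r)))).map Prod.fst = x.1.map Prod.fst ++ M := by
    rw [List.map_append, List.map_map]
    congr 1
    exact List.map_id M
  have hnd : ((x.1 ++ M.map (fun i => (i, (0 : ZMod r)))).map Prod.fst).Nodup := by
    rw [hmap, List.nodup_append]
    refine ⟨x.2, Finset.nodup_toList _, ?_⟩
    intro a ha b hb hab
    subst hab
    exact (hM _).1 hb ha
  refine ⟨mkW _ hnd, List.sublist_append_left _ _, ?_⟩
  change (x.1 ++ M.map (fun i => (i, (0 : ZMod r)))).length = n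
  rw [← List.length_map (f := Prod.fst), ← List.toFinset_card_of_nodup hnd]
  have : ((x.1 ++ M.map (fun i => (i, (0 : ZMod r)))).map Prod.fst).toFinset = Finset.univ := by
    ext i
    rw [hmap]
    simp only [List.mem_toFinset, List.mem_append, Finset.mem_univ, iff_true, hM]
    exact em _
  rw [this]
  simp

lemma rkC_coe {n r : ℕ} (w : CInjWord n r) : rkC n r (w : WithTop (CInjWord n r)) = wlen w := rfl

lemma bot_mem_max {P : Type*} [Preorder P] [OrderBot P] [OrderTop P] {A C : Set P}
    (hA : ⊥ ∈ A) (hC : C ∈ maxChainsIn A) : ⊥ ∈ C := by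
  obtain ⟨h1, h2, h3⟩ := hC
  have := h3 (insert ⊥ C) (Set.insert_subset hA h1) (h2.insert fun b _ _ => Or.inl bot_le)
    (Set.subset_insert _ _)
  rw [this]; exact Set.mem_insert _ _

lemma top_mem_max {P : Type*} [Preorder P] [OrderBot P] [OrderTop P] {A C : Set P}
    (hA : ⊤ ∈ A) (hC : C ∈ maxChainsIn A) : ⊤ ∈ C := by
  obtain ⟨h1, h2, h3⟩ := hC
  have := h3 (insert ⊤ C) (Set.insert_subset hA h1) (h2.insert fun b _ _ => Or.inr le_top)
    (Set.subset_insert _ _)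
  rw [this]; exact Set.mem_insert _ _

lemma chain_words {n r : ℕ} {C : Set (WithTop (CInjWord n r))} (hC : IsChain (· ≤ ·) C)
    {u v : CInjWord n r} (hu : (u : WithTop (CInjWord n r)) ∈ C)
    (hv : (v : WithTop (CInjWord n r)) ∈ C) (h : wlen u ≤ wlen v) : u ≤ v := by
  by_cases he : u = v
  · rw [he]
  · rcases hC hu hv (by simpa using he) with h1 | h1
    · exact WithTop.coe_le_coe.1 h1
    · have h2 : v ≤ u := WithTop.coe_le_coe.1 h1
      exact (eq_of_le_wlen h2 h).symm.le

lemma max_chain_rank {n r : ℕ} {T : Finset ℕ} {C : Set (WithTop (CInjWord n r))}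
    (hC : C ∈ maxChainsIn (rankSel (rkC n r) T)) {t : ℕ} (ht : t ∈ T) (htn : t ≤ n) :
    ∃ w : CInjWord n r, (w : WithTop (CInjWord n r)) ∈ C ∧ wlen w = t := by
  have hbot : ((⊥ : CInjWord n r) : WithTop (CInjWord n r)) ∈ C :=
    bot_mem_max (by simp [rankSel]) hC
  obtain ⟨h1, h2, h3⟩ := hC
  -- the largest element of rank at most `t`
  have hx : ∃ x : CInjWord n r, (x : WithTop (CInjWord n r)) ∈ C ∧ wlen x ≤ t ∧
      ∀ y : CInjWord n r, (y : WithTop (CInjWord n r)) ∈ C → wlen y ≤ t → wlen y ≤ wlen x := by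
    let s : Set ℕ := {k | ∃ x : CInjWord n r, (x : WithTop (CInjWord n r)) ∈ C ∧ wlen x = k ∧ k ≤ t}
    have hs : s.Nonempty := ⟨0, ⊥, hbot, rfl, by omega⟩
    have hb : BddAbove s := ⟨t, by rintro k ⟨_, _, _, h⟩; exact h⟩
    obtain ⟨x, hx1, hx2, hx3⟩ := Nat.sSup_mem hs hb
    exact ⟨x, hx1, by omega, fun y hy hyt => hx2 ▸ le_csSup hb ⟨y, hy, rfl, hyt⟩⟩
  obtain ⟨x, hxC, hxt, hxmax⟩ := hx
  have hz : ∃ z : CInjWord n r, wlen z = t ∧ x ≤ z ∧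
      ∀ y : CInjWord n r, (y : WithTop (CInjWord n r)) ∈ C → t < wlen y → z ≤ y := by
    by_cases hy : ∃ y : CInjWord n r, (y : WithTop (CInjWord n r)) ∈ C ∧ t < wlen y
    · let s : Set ℕ := {k | ∃ x : CInjWord n r, (x : WithTop (CInjWord n r)) ∈ C ∧ wlen x = k ∧ t < k}
      have hs : s.Nonempty := by
        obtain ⟨y, hy1, hy2⟩ := hy
        exact ⟨_, y, hy1, rfl, hy2⟩
      obtain ⟨y, hy1, hy2, hy3⟩ := Nat.sInf_mem hs
      have hxy := chain_words h2 hxC hy1 (by omega)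
      obtain ⟨z, hz1, hz2, hz3⟩ := word_interp hxy t hxt (by omega)
      refine ⟨z, hz3, hz1, fun y' hy' ht' => hz2.trans (chain_words h2 hy1 hy' ?_)⟩
      rw [hy2]
      exact Nat.sInf_le ⟨y', hy', rfl, ht'⟩
    · obtain ⟨y, hy1, hy2⟩ := word_extend x
      obtain ⟨z, hz1, hz2, hz3⟩ := word_interp hy1 t hxt (by omega)
      exact ⟨z, hz3, hz1, fun y' hy' ht' => absurd ⟨y', hy', ht'⟩ hy⟩
  obtain ⟨z, hzt, hxz, hzy⟩ := hz
  have := h3 (insert (z : WithTop (CInjWord n r)) C)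
    (Set.insert_subset (Or.inl (by change wlen z ∈ T; rw [hzt]; exact ht)) h1)
    (h2.insert fun b hb _ => by
      induction b using WithTop.recTopCoe with
      | top => exact Or.inl le_top
      | coe b =>
        rcases Nat.lt_or_ge t (wlen b) with hlt | hge
        · exact Or.inl (WithTop.coe_le_coe.2 (hzy b hb hlt))
        · exact Or.inr (WithTop.coe_le_coe.2
            ((chain_words h2 hb hxC (hxmax b hb hge)).trans hxz)))
    (Set.subset_insert _ _)
  refine ⟨z, ?_, hzt⟩
  rw [this]; exact Set.mem_insert _ _

/-- adjoin bottom and top to a finite set of words -/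
def adjoinBT {n r : ℕ} (D : Finset (CInjWord n r)) : Set (WithTop (CInjWord n r)) :=
  {⊥, ⊤} ∪ (fun w : CInjWord n r => (w : WithTop (CInjWord n r))) '' (D : Set (CInjWord n r))

lemma coe_mem_adjoinBT {n r : ℕ} {D : Finset (CInjWord n r)} {w : CInjWord n r} :
    (w : WithTop (CInjWord n r)) ∈ adjoinBT D ↔ w = ⊥ ∨ w ∈ D := by
  unfold adjoinBT
  rw [← WithTop.coe_bot]
  simp only [Set.mem_union, Set.mem_insert_iff, Set.mem_singleton_iff, WithTop.coe_inj,
    WithTop.coe_ne_top, or_false, Set.mem_image, Finset.mem_coe, exists_eq_right]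

lemma top_mem_adjoinBT {n r : ℕ} {D : Finset (CInjWord n r)} :
    (⊤ : WithTop (CInjWord n r)) ∈ adjoinBT D := by
  unfold adjoinBT; simp

lemma adjoin_mem_max {n r : ℕ} {T : Finset ℕ} {D : Finset (CInjWord n r)}
    (hD : IsChain (· ≤ ·) (D : Set (CInjWord n r))) (hT : D.image wlen = T) :
    adjoinBT D ∈ maxChainsIn (rankSel (rkC n r) T) := by
  refine ⟨?_, ?_, ?_⟩
  · intro b hb
    induction b using WithTop.recTopCoe with
    | top => simp [rankSel]
    | coe b =>
      rcases coe_mem_adjoinBT.1 hb with rfl | h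
      · simp [rankSel]
      · left
        change wlen b ∈ T
        rw [← hT]
        exact Finset.mem_image_of_mem _ h
  · intro a ha b hb hab
    induction a using WithTop.recTopCoe with
    | top => exact Or.inr le_top
    | coe a =>
      induction b using WithTop.recTopCoe with
      | top => exact Or.inl le_top
      | coe b =>
        rcases coe_mem_adjoinBT.1 ha with rfl | h
        · exact Or.inl (WithTop.coe_le_coe.2 bot_le)
        · rcases coe_mem_adjoinBT.1 hb with rfl | h'
          · exact Or.inr (WithTop.coe_le_coe.2 bot_le)
          · rcases hD h h' (by simpa using hab) with h'' | h''
            · exact Or.inl (WithTop.coe_le_coe.2 h'')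
            · exact Or.inr (WithTop.coe_le_coe.2 h'')
  · intro E hE hEc hDE
    refine Set.Subset.antisymm hDE ?_
    intro b hb
    induction b using WithTop.recTopCoe with
    | top => exact top_mem_adjoinBT
    | coe b =>
      rw [coe_mem_adjoinBT]
      rcases hE hb with h | h
      · have h' : wlen b ∈ T := h
        rw [← hT, Finset.mem_image] at h'
        obtain ⟨d, hd, hdb⟩ := h'
        have hdE := hDE (coe_mem_adjoinBT.2 (Or.inr hd))
        have := chain_words hEc hdE hb hdb.le
        rw [← eq_of_le_wlen this hdb.ge]
        exact Or.inr hd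
      · rw [← WithTop.coe_bot] at h
        simp only [Set.mem_insert_iff, Set.mem_singleton_iff, WithTop.coe_inj,
          WithTop.coe_ne_top, or_false] at h
        exact Or.inl h

lemma adjoin_fixed {n r : ℕ} {g : Equiv.Perm (Fin n)} {D : Finset (CInjWord n r)}
    (hD : ∀ w ∈ D, permCWord g w = w) :
    WithTop.map (permCWord g) '' adjoinBT D = adjoinBT D := by
  have h : ∀ b ∈ adjoinBT D, WithTop.map (permCWord g) b = b := by
    intro b hb
    induction b using WithTop.recTopCoe with
    | top => rfl
    | coe b =>
      rw [WithTop.map_coe]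
      rcases coe_mem_adjoinBT.1 hb with rfl | h
      · rfl
      · rw [hD b h]
  rw [Set.image_congr h, Set.image_id']

lemma gAlpha_eq (n r : ℕ) [NeZero r] (g : Equiv.Perm (Fin n)) (m : ℕ) (hm : m ≤ n) (T : Finset ℕ)
    (hT : T ⊆ Finset.Icc 1 m) :
    gAlpha (rkC n r) (fun w : Equiv.Perm (Fin n) => WithTop.map (permCWord w)) T g =
      (((chainsOf (fixW n r g m)).filter (fun D => D.image wlen = T)).card : ℤ) := by
  unfold gAlpha
  congr 1
  have hset : {C : Set (WithTop (CInjWord n r)) | C ∈ maxChainsIn (rankSel (rkC n r) T) ∧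
      WithTop.map (permCWord g) '' C = C} =
      adjoinBT '' (((chainsOf (fixW n r g m)).filter (fun D => D.image wlen = T) :
        Finset (Finset (CInjWord n r))) : Set (Finset (CInjWord n r))) := by
    ext C
    constructor
    · rintro ⟨hC, hg⟩
      have hbot : ((⊥ : CInjWord n r) : WithTop (CInjWord n r)) ∈ C :=
        bot_mem_max (by simp [rankSel]) hC
      have htop : (⊤ : WithTop (CInjWord n r)) ∈ C := top_mem_max (by simp [rankSel]) hC
      let D : Finset (CInjWord n r) :=
        Finset.univ.filter (fun w => (w : WithTop (CInjWord n r)) ∈ C ∧ 1 ≤ wlen w)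
      have hDm : ∀ w, w ∈ D ↔ (w : WithTop (CInjWord n r)) ∈ C ∧ 1 ≤ wlen w := by
        intro w; simp [D]
      have hrk : ∀ w ∈ D, wlen w ∈ T := by
        intro w hw
        rw [hDm] at hw
        rcases hC.1 hw.1 with h | h
        · exact h
        · rw [← WithTop.coe_bot] at h
          simp only [Set.mem_insert_iff, Set.mem_singleton_iff, WithTop.coe_inj,
            WithTop.coe_ne_top, or_false] at h
          rw [h, bot_wlen] at hw
          omega
      refine ⟨D, ?_, ?_⟩
      · rw [Finset.mem_coe, Finset.mem_filter, mem_chainsOf]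
        refine ⟨⟨?_, ?_⟩, ?_⟩
        · intro w hw
          have h1 := Finset.mem_Icc.1 (hT (hrk w hw))
          rw [hDm] at hw
          rw [mem_fixW]
          refine ⟨h1, ?_⟩
          have h2 : ((permCWord g w : CInjWord n r) : WithTop (CInjWord n r)) ∈ C := by
            rw [← hg]
            exact ⟨_, hw.1, rfl⟩
          have h3 := wlen_permC g w
          exact eq_of_le_wlen (chain_words hC.2.1 h2 hw.1 h3.le) h3.ge
        · intro u hu v hv _
          have hu' := (hDm _).1 (Finset.mem_coe.1 hu)
          have hv' := (hDm _).1 (Finset.mem_coe.1 hv)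
          rcases Nat.le_total (wlen u) (wlen v) with h | h
          · exact Or.inl (chain_words hC.2.1 hu'.1 hv'.1 h)
          · exact Or.inr (chain_words hC.2.1 hv'.1 hu'.1 h)
        · ext t
          rw [Finset.mem_image]
          constructor
          · rintro ⟨w, hw, rfl⟩; exact hrk w hw
          · intro ht
            have h1 := Finset.mem_Icc.1 (hT ht)
            obtain ⟨w, hw, hwt⟩ := max_chain_rank hC ht (by omega)
            exact ⟨w, (hDm _).2 ⟨hw, by omega⟩, hwt⟩
      · ext b
        induction b using WithTop.recTopCoe with
        | top => simp only [htop, top_mem_adjoinBT]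
        | coe b =>
          rw [coe_mem_adjoinBT, hDm]
          constructor
          · rintro (rfl | h)
            · exact hbot
            · exact h.1
          · intro h
            by_cases h0 : wlen b = 0
            · exact Or.inl (eq_bot_of_wlen h0)
            · exact Or.inr ⟨h, by omega⟩
    · rintro ⟨D, hD, rfl⟩
      rw [Finset.mem_coe, Finset.mem_filter, mem_chainsOf] at hD
      exact ⟨adjoin_mem_max hD.1.2 hD.2, adjoin_fixed fun w hw => (mem_fixW.1 (hD.1.1 hw)).2⟩
  rw [hset, Set.ncard_image_of_injOn, Set.ncard_coe_finset]
  intro D hD D' hD' he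
  rw [Finset.mem_coe, Finset.mem_filter, mem_chainsOf] at hD hD'
  have aux : ∀ {D : Finset (CInjWord n r)}, D ⊆ fixW n r g m → ∀ w,
      (w ∈ D ↔ (w : WithTop (CInjWord n r)) ∈ adjoinBT D ∧ 1 ≤ wlen w) := by
    intro D hD w
    rw [coe_mem_adjoinBT]
    constructor
    · intro h; exact ⟨Or.inr h, (mem_fixW.1 (hD h)).1.1⟩
    · rintro ⟨rfl | h, h'⟩
      · rw [bot_wlen] at h'; omega
      · exact h
  ext w
  rw [aux hD.1.1, aux hD'.1.1, he]

lemma cBeta_eq (n r : ℕ) [NeZero r] (g : Equiv.Perm (Fin n)) (m : ℕ) (hm : m ≤ n) :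
    cBeta n r (Finset.Icc 1 m) g =
      ∑ k ∈ Finset.range (m + 1), (-1) ^ (m - k) * ((r : ℤ) ^ k * (fixEmb n k g : ℤ)) := by
  have hcard : ∀ D ∈ chainsOf (fixW n r g m), (D.image wlen).card = D.card := by
    intro D hD
    rw [mem_chainsOf] at hD
    refine Finset.card_image_of_injOn ?_
    intro u hu v hv h
    by_contra hne
    rcases hD.2 hu hv hne with h' | h'
    · exact hne (eq_of_le_wlen h' h.ge)
    · exact hne (eq_of_le_wlen h' h.le).symm
  have hsub : ∀ D ∈ chainsOf (fixW n r g m), D.image wlen ∈ (Finset.Icc 1 m).powerset := by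
    intro D hD
    rw [mem_chainsOf] at hD
    rw [Finset.mem_powerset]
    intro t ht
    rw [Finset.mem_image] at ht
    obtain ⟨w, hw, rfl⟩ := ht
    exact Finset.mem_Icc.2 (mem_fixW.1 (hD.1 hw)).1
  have hsign : ∀ k, k ≤ m → (-1 : ℤ) ^ (m - k) = (-1) ^ m * (-1) ^ k := by
    intro k hk
    obtain ⟨d, rfl⟩ := Nat.exists_eq_add_of_le hk
    rw [Nat.add_sub_cancel_left, pow_add]
    have : ((-1 : ℤ) ^ k) * (-1) ^ k = 1 := by rw [← mul_pow]; simp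
    linear_combination (-(-1 : ℤ) ^ d) * this
  have h1 : cBeta n r (Finset.Icc 1 m) g = (-1) ^ m * chE (fixW n r g m) := by
    unfold cBeta gBeta chE
    rw [← Finset.sum_fiberwise_of_maps_to hsub, Finset.mul_sum]
    refine Finset.sum_congr rfl fun T hT => ?_
    rw [Finset.mem_powerset] at hT
    rw [gAlpha_eq n r g m hm T hT]
    have hTc : T.card ≤ m := by simpa using Finset.card_le_card hT
    rw [Finset.sum_congr rfl (g := fun _ => (-1 : ℤ) ^ T.card)]
    · rw [Finset.sum_const, Nat.card_Icc, Nat.add_sub_cancel, hsign _ hTc, nsmul_eq_mul]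
      ring
    · intro D hD
      rw [Finset.mem_filter] at hD
      rw [← hD.2, hcard D hD.1]
  rw [h1, chE_fixW, Finset.mul_sum]
  refine Finset.sum_congr rfl fun k hk => ?_
  rw [hsign k (by rw [Finset.mem_range] at hk; omega)]
  push_cast
  ring

/-! ### Final count -/

lemma zeroFirstRow_anti {μ : YoungDiagram} {r : ℕ} {Q : SYT μ} {c : Fin μ.card → ZMod r}
    {s t : ℕ} (h : s ≤ t) (ht : zeroFirstRow Q c t) : zeroFirstRow Q c s :=
  fun k hk => ht k (by omega)

lemma mQ_spec (n : ℕ) {r : ℕ} {μ : YoungDiagram} (Q : SYT μ) (c : Fin μ.card → ZMod r) (i : ℕ)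
    (hi : i ≤ n) : zeroFirstRow Q c i ↔ i ≤ mQ n Q c := by
  unfold mQ
  constructor
  · intro h
    exact Finset.le_max' _ _ (Finset.mem_filter.2 ⟨Finset.mem_range.2 (by omega), h⟩)
  · intro h
    exact zeroFirstRow_anti h (Finset.mem_filter.1 (Finset.max'_mem
      ((Finset.range (n + 1)).filter (fun i => zeroFirstRow Q c i)) _)).2

lemma mQ_le (n : ℕ) {r : ℕ} {μ : YoungDiagram} (Q : SYT μ) (c : Fin μ.card → ZMod r) :
    mQ n Q c ≤ n := by
  have := (Finset.mem_filter.1 (Finset.max'_mem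
      ((Finset.range (n + 1)).filter (fun i => zeroFirstRow Q c i))
      ⟨0, Finset.mem_filter.2 ⟨Finset.mem_range.2 (by omega),
      fun k hk => absurd hk (by omega)⟩⟩)).1
  rw [Finset.mem_range] at this
  unfold mQ
  omega

lemma card_zero_prefix (n r k : ℕ) [NeZero r] (hk : k ≤ n) :
    Nat.card {c : Fin n → ZMod r // ∀ i : Fin n, (i : ℕ) < n - k → c i = 0} = r ^ k := by
  have e : {c : Fin n → ZMod r // ∀ i : Fin n, (i : ℕ) < n - k → c i = 0} ≃
      ({i : Fin n // ¬ (i : ℕ) < n - k} → ZMod r) :=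
    ⟨fun c i => c.1 i.1, fun d => ⟨fun i => if h : (i : ℕ) < n - k then 0 else d ⟨i, h⟩,
      fun i hi => by simp [hi]⟩, fun c => by
        apply Subtype.ext
        funext i
        by_cases hi : (i : ℕ) < n - k
        · simp [hi, c.2 i hi]
        · simp [hi], fun d => by
        funext i
        simp [i.2]⟩
  rw [Nat.card_congr e, Nat.card_fun, Nat.card_zmod]
  congr 1
  have h2 : Nat.card {i : Fin n // (i : ℕ) < n - k} = n - k := by
    have e2 : {i : Fin n // (i : ℕ) < n - k} ≃ Fin (n - k) :=
      ⟨fun i => ⟨i.1, i.2⟩, fun i => ⟨⟨i, by omega⟩, i.2⟩, fun _ => rfl, fun _ => rfl⟩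
    rw [Nat.card_congr e2, Nat.card_fin]
  have h3 := Fintype.card_subtype_compl (fun i : Fin n => (i : ℕ) < n - k)
  rw [Nat.card_eq_fintype_card] at h2 ⊢
  rw [h3, h2, Fintype.card_fin]
  omega

lemma card_zeroFirstRow (n r k : ℕ) [NeZero r] (μ : YoungDiagram) (hμ : μ.card = n) (hk : k ≤ n) :
    Nat.card {Qc : SYT μ × (Fin μ.card → ZMod r) // zeroFirstRow Qc.1 Qc.2 (n - k)}
      = r ^ k * fSYTRow μ (n - k) := by
  subst hμ
  rw [← card_zero_prefix μ.card r k hk, mul_comm, fSYTRow, ← Nat.card_prod]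
  refine Nat.card_congr ⟨fun x => ⟨⟨x.1.1, ?_⟩, ⟨x.1.2, ?_⟩⟩, fun y => ⟨(y.1.1, y.2.1), ?_⟩,
    fun _ => rfl, fun _ => rfl⟩
  · intro j h1 h2
    have := (x.2 ⟨j - 1, by omega⟩ (by change j - 1 < _; omega)).1
    have e : j - 1 + 1 = j := by omega
    simpa only [e] using this
  · intro i hi
    exact (x.2 i hi).2
  · intro i hi
    exact ⟨y.1.2 _ (by omega) (by omega), y.2.2 i hi⟩

lemma sum_alt_even (m : ℕ) : ∑ i ∈ Finset.range (m + 1), (-1 : ℤ) ^ i = if Even m then 1 else 0 := by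
  induction m with
  | zero => simp
  | succ m ih =>
    rw [Finset.sum_range_succ, ih, pow_succ]
    by_cases h : Even m
    · simp [Nat.even_add_one, h, h.neg_one_pow]
    · simp [Nat.even_add_one, h, (Nat.not_even_iff_odd.1 h).neg_one_pow]

lemma sum_alt_le (n m : ℕ) (hm : m ≤ n) :
    ∑ i ∈ Finset.range (n + 1), (-1 : ℤ) ^ i * (if i ≤ m then 1 else 0)
      = if Even m then 1 else 0 := by
  rw [← sum_alt_even]
  simp only [mul_ite, mul_one, mul_zero]
  rw [← Finset.sum_filter]
  refine Finset.sum_congr ?_ fun _ _ => rfl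
  ext i
  simp only [Finset.mem_filter, Finset.mem_range]
  omega

lemma sum_alt_le' (n m : ℕ) (hm : m ≤ n) :
    ∑ i ∈ Finset.range n, (-1 : ℤ) ^ i * (if i + 1 ≤ m then 1 else 0)
      = if Odd m then 1 else 0 := by
  have h := sum_alt_le n m hm
  rw [Finset.sum_range_succ'] at h
  simp only [pow_succ, Nat.zero_le, if_true, pow_zero, mul_one] at h
  have h2 : ∑ i ∈ Finset.range n, (-1 : ℤ) ^ i * (-1) * (if i + 1 ≤ m then 1 else 0)
      = - ∑ i ∈ Finset.range n, (-1 : ℤ) ^ i * (if i + 1 ≤ m then 1 else 0) := by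
    rw [← Finset.sum_neg_distrib]
    exact Finset.sum_congr rfl fun i _ => by ring
  rw [h2] at h
  simp only [← Nat.not_even_iff_odd]
  by_cases he : Even m
  · simp only [he, if_true, not_true, if_false] at h ⊢
    linarith
  · simp only [he, if_false, not_false_iff, if_true] at h ⊢
    linarith

lemma card_subtype_int {X : Type*} [Fintype X] (p : X → Prop) :
    ((Nat.card {x // p x} : ℕ) : ℤ) = ∑ x, if p x then 1 else 0 := by
  rw [Nat.card_eq_fintype_card, Fintype.card_subtype, Finset.sum_boole]

lemma beta_chi (n r : ℕ) [NeZero r] (μ : YoungDiagram) (hμ : μ.card = n) (m : ℕ) (hm : m ≤ n) :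
    (∑ g : Equiv.Perm (Fin n), cBeta n r (Finset.Icc 1 m) g * chi n μ g⁻¹) =
      (∑ k ∈ Finset.range (m + 1), (-1 : ℤ) ^ (m - k) *
        (Nat.card {Qc : SYT μ × (Fin μ.card → ZMod r) // zeroFirstRow Qc.1 Qc.2 (n - k)} : ℤ))
        * (n.factorial : ℤ) := by
  simp only [cBeta_eq n r _ m hm, Finset.sum_mul]
  rw [Finset.sum_comm]
  refine Finset.sum_congr rfl fun k hk => ?_
  rw [Finset.mem_range] at hk
  rw [card_zeroFirstRow n r k μ hμ (by omega)]
  push_cast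
  have := sum_fixEmb_chi n k μ hμ (by omega)
  calc _ = (-1 : ℤ) ^ (m - k) * (r : ℤ) ^ k *
        ∑ g : Equiv.Perm (Fin n), (fixEmb n k g : ℤ) * chi n μ g⁻¹ := by
        rw [Finset.mul_sum]
        exact Finset.sum_congr rfl fun g _ => by ring
    _ = _ := by rw [this]; ring

/-- **Example 4.3**: for `S = {1,…,n-1}`, the multiplicity of `ρ^λ` in `β_P({1,…,n-1})`
(resp. `β_P({1,…,n})`) equals the number of `r`-colored standard Young tableaux `Q` of
shape `λ` for which the largest `i ∈ {0,1,…,n}` such that all of `1,…,i` appear in the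
first row of `Q` colored with the zero color is odd (resp. even).  (The multiplicity `M`
is characterized by `Σ_g φ(g) χ^λ(g⁻¹) = M * n!`.) -/
theorem statement15 (n r : ℕ) (hn : 0 < n) (hr : 0 < r) (μ : YoungDiagram)
    (hμ : μ.card = n) :
    ((∑ g : Equiv.Perm (Fin n), cBeta n r (Finset.Icc 1 (n - 1)) g * chi n μ g⁻¹) =
      (Nat.card {Qc : SYT μ × (Fin μ.card → ZMod r) // Odd (mQ n Qc.1 Qc.2)} : ℤ) *
        (n.factorial : ℤ)) ∧
    ((∑ g : Equiv.Perm (Fin n), cBeta n r (Finset.Icc 1 n) g * chi n μ g⁻¹) =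
      (Nat.card {Qc : SYT μ × (Fin μ.card → ZMod r) // Even (mQ n Qc.1 Qc.2)} : ℤ) *
        (n.factorial : ℤ)) := by
  have : NeZero r := ⟨by omega⟩
  have : Fintype (SYT μ) := Fintype.ofFinite _
  refine ⟨?_, ?_⟩
  · rw [beta_chi n r μ hμ (n - 1) (by omega)]
    congr 1
    rw [← Finset.sum_range_reflect, Nat.sub_add_cancel hn, card_subtype_int]
    refine Eq.trans ?_ (Finset.sum_congr rfl fun Qc _ => (sum_alt_le' n _ (mQ_le n Qc.1 Qc.2)).trans (by congr))
    rw [Finset.sum_comm]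
    refine Finset.sum_congr rfl fun i hi => ?_
    rw [Finset.mem_range] at hi
    have e1 : n - 1 - (n - 1 - i) = i := by omega
    have e2 : n - (n - 1 - i) = i + 1 := by omega
    rw [e1, e2, card_subtype_int, Finset.mul_sum]
    refine Finset.sum_congr rfl fun Qc _ => ?_
    simp only [mQ_spec n Qc.1 Qc.2 (i + 1) (by omega)]
  · rw [beta_chi n r μ hμ n le_rfl]
    congr 1
    rw [← Finset.sum_range_reflect, card_subtype_int]
    refine Eq.trans ?_ (Finset.sum_congr rfl fun Qc _ => (sum_alt_le n _ (mQ_le n Qc.1 Qc.2)).trans (by congr))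
    rw [Finset.sum_comm]
    refine Finset.sum_congr rfl fun i hi => ?_
    rw [Finset.mem_range] at hi
    have e1 : n - (n + 1 - 1 - i) = i := by omega
    rw [e1, card_subtype_int, Finset.mul_sum]
    refine Finset.sum_congr rfl fun Qc _ => ?_
    simp only [mQ_spec n Qc.1 Qc.2 i (by omega)]
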